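/- arXiv:2502.04741 — 2 statements merged into one kernel-verified Lean document; each statement's English description precedes it below -/
import Mathlib

section
/- If min{b,c} = 4, max{a,d} ≤ 3, m ≥ 6 and 2^(m-2) ≥ (max{b,c} − 1)·m², then forb(m, 3, F(a,b,c,d)) = forb(m, 3, 4·I_2) = forb(m, 3, 4·K_2) − 2 = 2^m + m·2^(m-1) + 3·binom(m,2) − 2. -/
open Finset

/-- `F` is a configuration in the simple matrix `A` (columns of `A` form a finset):
there is an injection of rows such that the multiset `F` of columns is a sub-multiset
of the restricted columns of `A`. -/
def ConfigIn {s k m : ℕ} (F : Multiset (Fin k → Fin s)) (A : Finset (Fin m → Fin s)) : Prop :=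
  ∃ ρ : Fin k ↪ Fin m, F ≤ A.1.map (fun col => col ∘ ρ)

/-- The forbidden number: the maximum number of columns of an `m`-rowed simple
`s`-matrix avoiding `F` as a configuration. -/
noncomputable def forb (m s : ℕ) {k : ℕ} (F : Multiset (Fin k → Fin s)) : ℕ :=
  sSup {n : ℕ | ∃ A : Finset (Fin m → Fin s), ¬ ConfigIn F A ∧ A.card = n}

/-- The 2-rowed configuration with `a` columns (0,0), `b` columns (1,0),
`c` columns (0,1) and `d` columns (1,1), viewed as a 3-matrix. -/
def Fabcd (a b c d : ℕ) : Multiset (Fin 2 → Fin 3) :=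
  Multiset.replicate a ![0, 0] + Multiset.replicate b ![1, 0] +
  Multiset.replicate c ![0, 1] + Multiset.replicate d ![1, 1]

/-- `p` copies of `K₂`. -/
def pK2 (p : ℕ) : Multiset (Fin 2 → Fin 3) := Fabcd p p p p

/-- `p` copies of `I₂`. -/
def pI2 (p : ℕ) : Multiset (Fin 2 → Fin 3) := Fabcd 0 p p 0


namespace ForbP4

/-- Translate a Boolean into a matrix entry. -/
def tr (b : Bool) : Fin 3 := if b then 1 else 0

lemma tr_ne_two (b : Bool) : tr b ≠ 2 := by cases b <;> decide

lemma tr_inj {a b : Bool} (h : tr a = tr b) : a = b := by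
  revert a b; decide

lemma exists_tr {x : Fin 3} (h : x ≠ 2) : ∃ b, x = tr b := by
  revert x; decide

/-- The number of columns of `A` with entries `u`, `v` in the rows `i`, `j`. -/
def cnt {m : ℕ} (A : Finset (Fin m → Fin 3)) (i j : Fin m) (u v : Fin 3) : ℕ :=
  (A.filter (fun x => x i = u ∧ x j = v)).card

lemma cnt_swap {m : ℕ} (A : Finset (Fin m → Fin 3)) (i j : Fin m) (u v : Fin 3) :
    cnt A i j u v = cnt A j i v u := by
  unfold cnt; congr 1; ext x; simp [and_comm]

lemma count_cfg {m : ℕ} (A : Finset (Fin m → Fin 3)) (ρ : Fin 2 ↪ Fin m) (u v : Fin 3) :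
    (A.1.map (fun col => col ∘ ρ)).count ![u, v] = cnt A (ρ 0) (ρ 1) u v := by
  rw [Multiset.count_map, cnt, Finset.card_def, Finset.filter_val]
  congr 1
  apply Multiset.filter_congr
  intro x _
  constructor
  · intro h
    exact ⟨(congrFun h 0).symm, (congrFun h 1).symm⟩
  · rintro ⟨h0, h1⟩
    funext k
    fin_cases k
    · simpa using h0.symm
    · simpa using h1.symm

lemma count_F (a b c d : ℕ) (w : Fin 2 → Fin 3) : (Fabcd a b c d).count w =
    (if ![0,0] = w then a else 0) + (if ![1,0] = w then b else 0) +
    (if ![0,1] = w then c else 0) + (if ![1,1] = w then d else 0) := by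
  simp [Fabcd, Multiset.count_replicate]

lemma config_iff {m : ℕ} (A : Finset (Fin m → Fin 3)) (a b c d : ℕ) :
    ConfigIn (Fabcd a b c d) A ↔ ∃ i j : Fin m, i ≠ j ∧ a ≤ cnt A i j 0 0 ∧ b ≤ cnt A i j 1 0 ∧
      c ≤ cnt A i j 0 1 ∧ d ≤ cnt A i j 1 1 := by
  have e1 : (![0,0] : Fin 2 → Fin 3) ≠ ![1,0] := by decide
  have e2 : (![0,0] : Fin 2 → Fin 3) ≠ ![0,1] := by decide
  have e3 : (![0,0] : Fin 2 → Fin 3) ≠ ![1,1] := by decide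
  have e4 : (![1,0] : Fin 2 → Fin 3) ≠ ![0,1] := by decide
  have e5 : (![1,0] : Fin 2 → Fin 3) ≠ ![1,1] := by decide
  have e6 : (![0,1] : Fin 2 → Fin 3) ≠ ![1,1] := by decide
  constructor
  · rintro ⟨ρ, h⟩
    rw [Multiset.le_iff_count] at h
    refine ⟨ρ 0, ρ 1, fun h => absurd (ρ.injective h) (by decide), ?_, ?_, ?_, ?_⟩
    · have := h ![0,0]
      rw [count_cfg, count_F, if_pos rfl, if_neg e1.symm, if_neg e2.symm, if_neg e3.symm] at this
      omega
    · have := h ![1,0]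
      rw [count_cfg, count_F, if_pos rfl, if_neg e1, if_neg e4.symm, if_neg e5.symm] at this
      omega
    · have := h ![0,1]
      rw [count_cfg, count_F, if_pos rfl, if_neg e2, if_neg e4, if_neg e6.symm] at this
      omega
    · have := h ![1,1]
      rw [count_cfg, count_F, if_pos rfl, if_neg e3, if_neg e5, if_neg e6] at this
      omega
  · rintro ⟨i, j, hij, h0, h1, h2, h3⟩
    let ρ : Fin 2 ↪ Fin m := ⟨![i, j], by
      intro x y hxy
      fin_cases x <;> fin_cases y <;> simp_all [eq_comm]⟩
    refine ⟨ρ, ?_⟩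
    rw [Multiset.le_iff_count]
    intro w
    rw [count_F]
    have r0 : ρ 0 = i := rfl
    have r1 : ρ 1 = j := rfl
    by_cases w0 : ![0,0] = w
    · subst w0
      rw [count_cfg, if_pos rfl, if_neg e1.symm, if_neg e2.symm, if_neg e3.symm, r0, r1]
      omega
    by_cases w1 : ![1,0] = w
    · subst w1
      rw [count_cfg, if_pos rfl, if_neg e1, if_neg e4.symm, if_neg e5.symm, r0, r1]
      omega
    by_cases w2 : ![0,1] = w
    · subst w2
      rw [count_cfg, if_pos rfl, if_neg e2, if_neg e4, if_neg e6.symm, r0, r1]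
      omega
    by_cases w3 : ![1,1] = w
    · subst w3
      rw [count_cfg, if_pos rfl, if_neg e3, if_neg e5, if_neg e6, r0, r1]
      omega
    rw [if_neg w0, if_neg w1, if_neg w2, if_neg w3]
    simp

lemma forb_eq {m n : ℕ} (F : Multiset (Fin 2 → Fin 3))
    (hu : ∀ A : Finset (Fin m → Fin 3), ¬ ConfigIn F A → A.card ≤ n)
    (hl : ∃ A : Finset (Fin m → Fin 3), ¬ ConfigIn F A ∧ n ≤ A.card) : forb m 3 F = n := by
  obtain ⟨A, hA, hn⟩ := hl
  apply IsGreatest.csSup_eq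
  refine ⟨⟨A, hA, le_antisymm (hu A hA) hn⟩, ?_⟩
  rintro k ⟨B, hB, rfl⟩
  exact hu B hB

/-- keep the entries in `U`, replace the others by `2` -/
def mask {m : ℕ} (U : Finset (Fin m)) (c : Fin m → Fin 3) : Fin m → Fin 3 :=
  fun i => if i ∈ U then c i else 2

def supp {m : ℕ} (c : Fin m → Fin 3) : Finset (Fin m) := univ.filter (fun i => c i ≠ 2)

/-- Violation of the pattern assignment `P` at the pair `i, j`. -/
def Viol {m : ℕ} (P : Fin m → Fin m → Bool × Bool) (c : Fin m → Fin 3) (i j : Fin m) : Prop :=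
  c i = tr (P i j).1 ∧ c j = tr (P i j).2

instance {m : ℕ} (P : Fin m → Fin m → Bool × Bool) (c : Fin m → Fin 3) (i j : Fin m) :
    Decidable (Viol P c i j) := by unfold Viol; infer_instance

lemma mask_step {m : ℕ} (P : Fin m → Fin m → Bool × Bool) (X : Finset (Fin m → Fin 3))
    (U : Finset (Fin m)) (x : Fin m) (hx : x ∉ U)
    (h2 : ∀ c ∈ X, ∀ i ∈ insert x U, c i ≠ 2)
    (hP : ∀ c ∈ X, ∀ i j, i ≠ j → ¬ Viol P c i j) :
    (X.image (mask (insert x U))).card ≤ (X.image (mask U)).card + 1 := by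
  classical
  set Z0 := (X.filter (fun c => c x = 0)).image (mask U) with hZ0
  set Z1 := (X.filter (fun c => c x = 1)).image (mask U) with hZ1
  have hsub : X.image (mask (insert x U)) ⊆
      Z0.image (fun z => Function.update z x 0) ∪ Z1.image (fun z => Function.update z x 1) := by
    intro y hy
    obtain ⟨c, hc, rfl⟩ := Finset.mem_image.1 hy
    have key : mask (insert x U) c = Function.update (mask U c) x (c x) := by
      funext i
      by_cases hi : i = x
      · subst hi; simp [mask]
      · simp [mask, hi]
    have hcx := h2 c hc x (Finset.mem_insert_self _ _)
    obtain ⟨b, hb⟩ := exists_tr hcx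
    rw [Finset.mem_union]
    cases b
    · left
      refine Finset.mem_image.2 ⟨mask U c, Finset.mem_image.2 ⟨c, Finset.mem_filter.2 ⟨hc, hb⟩, rfl⟩, ?_⟩
      rw [key, hb]; rfl
    · right
      refine Finset.mem_image.2 ⟨mask U c, Finset.mem_image.2 ⟨c, Finset.mem_filter.2 ⟨hc, hb⟩, rfl⟩, ?_⟩
      rw [key, hb]; rfl
  have h1 : (X.image (mask (insert x U))).card ≤ Z0.card + Z1.card :=
    (Finset.card_le_card hsub).trans ((Finset.card_union_le _ _).trans
      (Nat.add_le_add Finset.card_image_le Finset.card_image_le))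
  have h3 : (Z0 ∪ Z1).card ≤ (X.image (mask U)).card := by
    apply Finset.card_le_card
    apply Finset.union_subset <;> exact Finset.image_subset_image (Finset.filter_subset _ _)
  have h4 : (Z0 ∩ Z1).card ≤ 1 := by
    rw [Finset.card_le_one]
    intro z hz w hw
    by_contra hne
    rw [Finset.mem_inter] at hz hw
    obtain ⟨y, hy⟩ := Function.ne_iff.1 hne
    have get0 : ∀ z ∈ Z0, ∃ c ∈ X, c x = tr false ∧ mask U c = z := by
      intro z hz
      obtain ⟨c, hc, e⟩ := Finset.mem_image.1 hz
      exact ⟨c, (Finset.mem_filter.1 hc).1, (Finset.mem_filter.1 hc).2, e⟩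
    have get1 : ∀ z ∈ Z1, ∃ c ∈ X, c x = tr true ∧ mask U c = z := by
      intro z hz
      obtain ⟨c, hc, e⟩ := Finset.mem_image.1 hz
      exact ⟨c, (Finset.mem_filter.1 hc).1, (Finset.mem_filter.1 hc).2, e⟩
    have get : ∀ z, z ∈ Z0 ∧ z ∈ Z1 → ∀ b, ∃ c ∈ X, c x = tr b ∧ mask U c = z := by
      intro z hz b
      cases b
      · exact get0 z hz.1
      · exact get1 z hz.2
    have hyU : y ∈ U := by
      by_contra hyU
      obtain ⟨c, _, _, rfl⟩ := get z hz true
      obtain ⟨c', _, _, rfl⟩ := get w hw true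
      simp [mask, hyU] at hy
    have hxy : x ≠ y := fun h => hx (h ▸ hyU)
    -- some of z, w has the forbidden value at y
    have : ∃ v, (v ∈ Z0 ∧ v ∈ Z1) ∧ v y = tr (P x y).2 := by
      obtain ⟨c, hc, _, ec⟩ := get z hz true
      obtain ⟨c', hc', _, ec'⟩ := get w hw true
      obtain ⟨b, hb⟩ := exists_tr (h2 c hc y (Finset.mem_insert_of_mem hyU))
      obtain ⟨b', hb'⟩ := exists_tr (h2 c' hc' y (Finset.mem_insert_of_mem hyU))
      have e1 : z y = tr b := by rw [← ec, ← hb]; simp [mask, hyU]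
      have e2 : w y = tr b' := by rw [← ec', ← hb']; simp [mask, hyU]
      have hbb : b ≠ b' := by
        rintro rfl; exact hy (e1.trans e2.symm)
      by_cases hq : b = (P x y).2
      · exact ⟨z, hz, by rw [e1, hq]⟩
      · refine ⟨w, hw, ?_⟩
        rw [e2]
        congr 1
        revert hq hbb; cases b <;> cases b' <;> cases (P x y).2 <;> simp
    obtain ⟨v, hv, hvy⟩ := this
    obtain ⟨c, hc, hcx, ec⟩ := get v hv (P x y).1
    refine hP c hc x y hxy ⟨hcx, ?_⟩
    rw [← hvy, ← ec]; simp [mask, hyU]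
  have := Finset.card_union_add_card_inter Z0 Z1
  omega

lemma mask_union {m : ℕ} (P : Fin m → Fin m → Bool × Bool) (X : Finset (Fin m → Fin 3))
    (S T : Finset (Fin m))
    (h2 : ∀ c ∈ X, ∀ i ∈ S, c i ≠ 2) (hT : T ⊆ S)
    (hP : ∀ c ∈ X, ∀ i j, i ≠ j → ¬ Viol P c i j) (W : Finset (Fin m)) (hW : W ⊆ S \ T) :
    (X.image (mask (W ∪ T))).card ≤ (X.image (mask T)).card + W.card := by
  classical
  induction W using Finset.induction_on with
  | empty => simp
  | insert x W hx ih =>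
    have hxS := hW (Finset.mem_insert_self x W)
    have hWS : W ⊆ S \ T := (Finset.subset_insert x W).trans hW
    rw [Finset.mem_sdiff] at hxS
    have := mask_step P X (W ∪ T) x (by simp [hx, hxS.2]) (by
      intro c hc i hi
      apply h2 c hc
      rw [Finset.mem_insert, Finset.mem_union] at hi
      rcases hi with rfl | hi | hi
      · exact hxS.1
      · exact (Finset.mem_sdiff.1 (hWS hi)).1
      · exact hT hi) hP
    rw [Finset.insert_union, Finset.card_insert_of_notMem hx]
    have := ih hWS
    omega

lemma card_fiber {m : ℕ} (P : Fin m → Fin m → Bool × Bool) (X : Finset (Fin m → Fin 3))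
    (S T : Finset (Fin m)) (hS : ∀ c ∈ X, supp c = S) (hT : T ⊆ S)
    (hP : ∀ c ∈ X, ∀ i j, i ≠ j → ¬ Viol P c i j) :
    X.card + T.card ≤ (X.image (mask T)).card + S.card := by
  classical
  have h2 : ∀ c ∈ X, ∀ i ∈ S, c i ≠ 2 := by
    intro c hc i hi
    rw [← hS c hc] at hi
    simpa [supp] using hi
  have h := mask_union P X S T h2 hT hP (S \ T) (le_refl _)
  rw [Finset.sdiff_union_of_subset hT] at h
  have e : (X.image (mask S)).card = X.card := by
    have : X.image (mask S) = X := by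
      conv_rhs => rw [← Finset.image_id (s := X)]
      apply Finset.image_congr
      intro c hc
      funext i
      have := hS c hc
      by_cases hi : i ∈ S
      · simp [mask, hi]
      · have h3 : c i = 2 := by
          rw [← this] at hi
          simpa [supp] using hi
        simp [mask, hi, h3]
    rw [this]
  have := Finset.card_sdiff_add_card_eq_card hT
  omega

lemma sum_base (m : ℕ) : ∑ S : Finset (Fin m), (S.card + 1) = 2 ^ m + m * 2 ^ (m - 1) := by
  rw [Finset.sum_add_distrib, ← Finset.powerset_univ, Finset.sum_powerset_apply_card (fun k => k)]
  simp only [smul_eq_mul, Finset.card_univ, Fintype.card_fin, Finset.sum_const,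
    Finset.card_powerset, mul_one]
  have := Nat.sum_range_mul_choose m
  simp only [mul_comm] at this ⊢
  omega

/-- The basic bound on families without violations. -/
lemma base_bound {m : ℕ} (P : Fin m → Fin m → Bool × Bool) (X : Finset (Fin m → Fin 3))
    (hP : ∀ c ∈ X, ∀ i j, i ≠ j → ¬ Viol P c i j) :
    X.card ≤ ∑ S : Finset (Fin m), (S.card + 1) := by
  classical
  rw [Finset.card_eq_sum_card_fiberwise (f := supp) (t := univ) (by intro x _; simp)]
  apply Finset.sum_le_sum
  intro S _
  have := card_fiber P (X.filter (fun c => supp c = S)) S ∅ (by simp) (by simp)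
    (fun c hc => hP c (Finset.mem_filter.1 hc).1)
  have h1 : ((X.filter (fun c => supp c = S)).image (mask ∅)).card ≤ 1 := by
    rw [Finset.card_le_one]
    intro a ha b hb
    obtain ⟨c, _, rfl⟩ := Finset.mem_image.1 ha
    obtain ⟨c', _, rfl⟩ := Finset.mem_image.1 hb
    funext i; simp [mask]
  simp only [Finset.card_empty] at this
  omega

lemma base_loss {m : ℕ} (P : Fin m → Fin m → Bool × Bool) (X : Finset (Fin m → Fin 3))
    (hP : ∀ c ∈ X, ∀ i j, i ≠ j → ¬ Viol P c i j) (T : Finset (Fin m))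
    (hT : ((X.filter (fun c => T ⊆ supp c)).image (mask T)).card ≤ T.card) :
    X.card + 2 ^ (m - T.card) ≤ ∑ S : Finset (Fin m), (S.card + 1) := by
  classical
  have hI : 2 ^ (m - T.card) = ∑ S : Finset (Fin m), (if T ⊆ S then 1 else 0) := by
    rw [← Finset.card_filter]
    have := Finset.card_Icc_finset (Finset.subset_univ T)
    rw [Finset.card_univ, Fintype.card_fin] at this
    rw [← this]
    congr 1
    ext S; simp
  rw [hI, Finset.card_eq_sum_card_fiberwise (f := supp) (t := univ) (by intro x _; simp),
    ← Finset.sum_add_distrib]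
  apply Finset.sum_le_sum
  intro S _
  by_cases hTS : T ⊆ S
  · rw [if_pos hTS]
    have := card_fiber P (X.filter (fun c => supp c = S)) S T (by simp) hTS
      (fun c hc => hP c (Finset.mem_filter.1 hc).1)
    have h1 : ((X.filter (fun c => supp c = S)).image (mask T)).card ≤
        ((X.filter (fun c => T ⊆ supp c)).image (mask T)).card := by
      apply Finset.card_le_card
      apply Finset.image_subset_image
      intro c hc
      rw [Finset.mem_filter] at hc ⊢
      exact ⟨hc.1, hc.2 ▸ hTS⟩
    omega
  · rw [if_neg hTS]
    have := card_fiber P (X.filter (fun c => supp c = S)) S ∅ (by simp) (by simp)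
      (fun c hc => hP c (Finset.mem_filter.1 hc).1)
    have h1 : ((X.filter (fun c => supp c = S)).image (mask ∅)).card ≤ 1 := by
      rw [Finset.card_le_one]
      intro a ha b hb
      obtain ⟨c, _, rfl⟩ := Finset.mem_image.1 ha
      obtain ⟨c', _, rfl⟩ := Finset.mem_image.1 hb
      funext i; simp [mask]
    simp only [Finset.card_empty] at this
    omega

/-- the pairs of rows -/
def prs (m : ℕ) : Finset (Fin m × Fin m) := univ.filter (fun q => q.1 < q.2)

lemma card_prs (m : ℕ) : (prs m).card = m.choose 2 := by
  unfold prs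
  rw [Finset.card_filter, Fintype.sum_prod_type_right]
  simp only [← Finset.card_filter]
  have : ∀ y : Fin m, (univ.filter (fun x : Fin m => x < y)).card = (y : ℕ) := by
    intro y
    rw [← Fin.card_Iio]
    congr 1
    ext; simp
  simp only [this]
  rw [Fin.sum_univ_eq_sum_range (fun i => i) m, Finset.sum_range_id, Nat.choose_two_right]

/-- The symmetry of a pattern assignment. -/
def SymP {m : ℕ} (P : Fin m → Fin m → Bool × Bool) : Prop :=
  ∀ i j, i ≠ j → P j i = (P i j).swap

lemma viol_symm {m : ℕ} {P : Fin m → Fin m → Bool × Bool} (hS : SymP P) (c : Fin m → Fin 3)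
    {i j : Fin m} (hij : i ≠ j) : Viol P c i j ↔ Viol P c j i := by
  unfold Viol
  rw [hS i j hij]
  simp [and_comm]

/-- columns without violation -/
def good {m : ℕ} (P : Fin m → Fin m → Bool × Bool) (A : Finset (Fin m → Fin 3)) :
    Finset (Fin m → Fin 3) := A.filter (fun c => ∀ i j, i ≠ j → ¬ Viol P c i j)

def bad {m : ℕ} (P : Fin m → Fin m → Bool × Bool) (A : Finset (Fin m → Fin 3)) :
    Finset (Fin m → Fin 3) := A.filter (fun c => ¬ ∀ i j, i ≠ j → ¬ Viol P c i j)

def violSet {m : ℕ} (P : Fin m → Fin m → Bool × Bool) (A : Finset (Fin m → Fin 3))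
    (i j : Fin m) : Finset (Fin m → Fin 3) := A.filter (fun c => Viol P c i j)

/-- columns whose only violation is at `u, v` -/
def solo {m : ℕ} (P : Fin m → Fin m → Bool × Bool) (A : Finset (Fin m → Fin 3))
    (u v : Fin m) : Finset (Fin m → Fin 3) :=
  A.filter (fun c => Viol P c u v ∧ ∀ i j, i ≠ j → Viol P c i j → (i = u ∧ j = v) ∨ (i = v ∧ j = u))

lemma good_bad {m : ℕ} (P : Fin m → Fin m → Bool × Bool) (A : Finset (Fin m → Fin 3)) :
    (good P A).card + (bad P A).card = A.card :=
  Finset.card_filter_add_card_filter_not _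

lemma bad_exists {m : ℕ} {P : Fin m → Fin m → Bool × Bool} (hS : SymP P)
    {A : Finset (Fin m → Fin 3)} {c : Fin m → Fin 3} (hc : c ∈ bad P A) :
    c ∈ A ∧ ∃ q ∈ prs m, Viol P c q.1 q.2 := by
  rw [bad, Finset.mem_filter] at hc
  refine ⟨hc.1, ?_⟩
  have h := hc.2
  push Not at h
  obtain ⟨i, j, hij, hv⟩ := h
  rcases lt_or_gt_of_ne hij with h | h
  · exact ⟨(i, j), by simp [prs, h], hv⟩
  · exact ⟨(j, i), by simp [prs, h], (viol_symm hS c hij).1 hv⟩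

lemma bad_le {m : ℕ} {P : Fin m → Fin m → Bool × Bool} (hS : SymP P)
    (A : Finset (Fin m → Fin 3)) (t : Fin m → Fin m → ℕ)
    (ht : ∀ i j, i ≠ j → (violSet P A i j).card ≤ t i j) :
    (bad P A).card ≤ ∑ q ∈ prs m, t q.1 q.2 := by
  classical
  have : bad P A ⊆ (prs m).biUnion (fun q => violSet P A q.1 q.2) := by
    intro c hc
    obtain ⟨hA, q, hq, hv⟩ := bad_exists hS hc
    exact Finset.mem_biUnion.2 ⟨q, hq, Finset.mem_filter.2 ⟨hA, hv⟩⟩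
  refine (Finset.card_le_card this).trans (Finset.card_biUnion_le.trans ?_)
  apply Finset.sum_le_sum
  intro q hq
  apply ht
  have : q.1 < q.2 := by simpa [prs] using hq
  exact this.ne

lemma bad_le_solo' {m : ℕ} {P : Fin m → Fin m → Bool × Bool} (hS : SymP P)
    (A : Finset (Fin m → Fin 3)) (t : Fin m → Fin m → ℕ)
    (ht : ∀ i j, i ≠ j → (violSet P A i j).card ≤ t i j) (u v : Fin m) (huv : u < v) :
    (bad P A).card + t u v ≤ ∑ q ∈ prs m, t q.1 q.2 + (solo P A u v).card := by
  classical
  have hmem : (u, v) ∈ prs m := by simp [prs, huv]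
  have : bad P A ⊆ solo P A u v ∪
      ((prs m).erase (u, v)).biUnion (fun q => violSet P A q.1 q.2) := by
    intro c hc
    obtain ⟨hA, q, hq, hv⟩ := bad_exists hS hc
    rw [Finset.mem_union]
    by_cases hex : ∃ q ∈ (prs m).erase (u, v), Viol P c q.1 q.2
    · right
      obtain ⟨q, hq, hv⟩ := hex
      exact Finset.mem_biUnion.2 ⟨q, hq, Finset.mem_filter.2 ⟨hA, hv⟩⟩
    · left
      have hall : ∀ q ∈ prs m, Viol P c q.1 q.2 → q = (u, v) := by
        intro q hq hv
        by_contra hne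
        exact hex ⟨q, Finset.mem_erase.2 ⟨hne, hq⟩, hv⟩
      refine Finset.mem_filter.2 ⟨hA, ?_, ?_⟩
      · have := hall q hq hv
        subst this; exact hv
      · intro i j hij hvi
        rcases lt_or_gt_of_ne hij with h | h
        · have := hall (i, j) (by simp [prs, h]) hvi
          simp only [Prod.mk.injEq] at this
          exact Or.inl this
        · have := hall (j, i) (by simp [prs, h]) ((viol_symm hS c hij).1 hvi)
          simp only [Prod.mk.injEq] at this
          exact Or.inr this.symm
  have h1 := (Finset.card_le_card this).trans (Finset.card_union_le _ _)
  have h2 : (((prs m).erase (u, v)).biUnion (fun q => violSet P A q.1 q.2)).card ≤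
      ∑ q ∈ (prs m).erase (u, v), t q.1 q.2 := by
    refine Finset.card_biUnion_le.trans ?_
    apply Finset.sum_le_sum
    intro q hq
    apply ht
    have : q.1 < q.2 := by simpa [prs] using (Finset.mem_erase.1 hq).2
    exact this.ne
  have h3 := Finset.sum_erase_add (prs m) (fun q => t q.1 q.2) hmem
  simp only at h3
  omega

lemma bad_le_solo {m : ℕ} {P : Fin m → Fin m → Bool × Bool} (hS : SymP P)
    (A : Finset (Fin m → Fin 3)) (t : Fin m → Fin m → ℕ) (hts : ∀ i j, i ≠ j → t i j = t j i)
    (ht : ∀ i j, i ≠ j → (violSet P A i j).card ≤ t i j) (u v : Fin m) (huv : u ≠ v) :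
    (bad P A).card + t u v ≤ ∑ q ∈ prs m, t q.1 q.2 + (solo P A u v).card := by
  rcases lt_or_gt_of_ne huv with h | h
  · exact bad_le_solo' hS A t ht u v h
  · have := bad_le_solo' hS A t ht v u h
    rw [hts u v huv]
    have e : solo P A u v = solo P A v u := by
      unfold solo
      ext c
      simp only [Finset.mem_filter, viol_symm hS c huv, or_comm]
    rw [e]; exact this

lemma exists_symP {m : ℕ} (Q : Fin m → Fin m → Bool × Bool → Prop)
    (hQ : ∀ i j, i ≠ j → ∃ p, Q i j p) (hs : ∀ i j p, i ≠ j → Q i j p → Q j i p.swap) :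
    ∃ P, SymP P ∧ ∀ i j, i ≠ j → Q i j (P i j) := by
  classical
  choose! f hf using hQ
  refine ⟨fun i j => if i < j then f i j else (f j i).swap, ?_, ?_⟩
  · intro i j hij
    rcases lt_or_gt_of_ne hij with h | h
    · simp [h, h.not_gt]
    · simp [h, h.not_gt]
  · intro i j hij
    rcases lt_or_gt_of_ne hij with h | h
    · simp [h, hf i j hij]
    · simp only [h.not_gt, if_false]
      exact hs j i _ hij.symm (hf j i hij.symm)

lemma violSet_card {m : ℕ} (P : Fin m → Fin m → Bool × Bool) (A : Finset (Fin m → Fin 3))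
    (i j : Fin m) : (violSet P A i j).card = cnt A i j (tr (P i j).1) (tr (P i j).2) := rfl

lemma good_viol {m : ℕ} (P : Fin m → Fin m → Bool × Bool) (A : Finset (Fin m → Fin 3)) :
    ∀ c ∈ good P A, ∀ i j, i ≠ j → ¬ Viol P c i j :=
  fun _ hc => (Finset.mem_filter.1 hc).2

/-- Upper bound for `4 K_2`. -/
lemma upper_K {m : ℕ} (A : Finset (Fin m → Fin 3)) (h : ¬ ConfigIn (pK2 4) A) :
    A.card ≤ 2 ^ m + m * 2 ^ (m - 1) + 3 * m.choose 2 := by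
  rw [pK2, config_iff] at h
  obtain ⟨P, hS, hP⟩ := exists_symP (fun i j p => cnt A i j (tr p.1) (tr p.2) ≤ 3) (by
    intro i j hij
    by_contra hcon
    push Not at hcon
    exact h ⟨i, j, hij, hcon (false, false), hcon (true, false), hcon (false, true),
      hcon (true, true)⟩) (by
    intro i j p _ hp
    rw [cnt_swap]; exact hp)
  have h1 := bad_le hS A (fun _ _ => 3) (fun i j hij => (violSet_card P A i j).trans_le (hP i j hij))
  have h2 := base_bound P (good P A) (good_viol P A)
  have h3 := good_bad P A
  rw [sum_base] at h2
  rw [Finset.sum_const, card_prs, smul_eq_mul] at h1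
  omega

/-- Boolean triples compatible with three patterns. -/
def compat (p q r : Bool × Bool) : Finset (Bool × Bool × Bool) :=
  univ.filter (fun b => (b.1, b.2.1) ≠ p ∧ (b.2.1, b.2.2) ≠ q ∧ (b.1, b.2.2) ≠ r)

lemma triple_loss {m : ℕ} (P : Fin m → Fin m → Bool × Bool) (X : Finset (Fin m → Fin 3))
    (hP : ∀ c ∈ X, ∀ i j, i ≠ j → ¬ Viol P c i j) (x y z : Fin m) (hxy : x ≠ y) (hyz : y ≠ z)
    (hxz : x ≠ z) (hc : (compat (P x y) (P y z) (P x z)).card ≤ 3) :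
    X.card + 2 ^ (m - 3) ≤ ∑ S : Finset (Fin m), (S.card + 1) := by
  classical
  have hT : ({x, y, z} : Finset (Fin m)).card = 3 := Finset.card_eq_three.2 ⟨x, y, z, hxy, hxz, hyz, rfl⟩
  have := base_loss P X hP {x, y, z} ?_
  · rwa [hT] at this
  · rw [hT]
    refine le_trans ?_ hc
    refine le_trans (Finset.card_le_card ?_) (Finset.card_image_le
      (f := fun b : Bool × Bool × Bool => fun w : Fin m => if w = x then tr b.1 else if w = y then tr b.2.1 else
        if w = z then tr b.2.2 else 2))
    intro d hd
    obtain ⟨c, hcX, rfl⟩ := Finset.mem_image.1 hd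
    rw [Finset.mem_filter] at hcX
    have hsub := hcX.2
    have g : ∀ w ∈ ({x, y, z} : Finset (Fin m)), ∃ b, c w = tr b := by
      intro w hw
      have := hsub hw
      apply exists_tr
      simpa [supp] using this
    obtain ⟨b1, h1⟩ := g x (by simp)
    obtain ⟨b2, h2⟩ := g y (by simp)
    obtain ⟨b3, h3⟩ := g z (by simp)
    refine Finset.mem_image.2 ⟨(b1, b2, b3), ?_, ?_⟩
    · simp only [compat, Finset.mem_filter, Finset.mem_univ, true_and]
      refine ⟨?_, ?_, ?_⟩
      · intro e; apply hP c hcX.1 x y hxy; rw [Viol, ← e]; exact ⟨h1, h2⟩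
      · intro e; apply hP c hcX.1 y z hyz; rw [Viol, ← e]; exact ⟨h2, h3⟩
      · intro e; apply hP c hcX.1 x z hxz; rw [Viol, ← e]; exact ⟨h1, h3⟩
    · funext w
      by_cases wx : w = x
      · subst wx; simp [mask, h1]
      by_cases wy : w = y
      · subst wy; simp [mask, h2, wx]
      by_cases wz : w = z
      · subst wz; simp [mask, h3, wx, wy]
      simp [mask, wx, wy, wz]

lemma pair_loss {m : ℕ} (P : Fin m → Fin m → Bool × Bool) (X : Finset (Fin m → Fin 3))
    (hP : ∀ c ∈ X, ∀ i j, i ≠ j → ¬ Viol P c i j) (x y : Fin m) (hxy : x ≠ y)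
    (hc : ∀ c ∈ X, ∀ b, ¬ (c x = tr b ∧ c y = tr (!b))) :
    X.card + 2 ^ (m - 2) ≤ ∑ S : Finset (Fin m), (S.card + 1) := by
  classical
  have hT : ({x, y} : Finset (Fin m)).card = 2 := Finset.card_pair hxy
  have := base_loss P X hP {x, y} ?_
  · rwa [hT] at this
  · rw [hT]
    have h2 : (univ : Finset Bool).card ≤ 2 := by simp
    refine le_trans ?_ h2
    refine le_trans (Finset.card_le_card ?_) (Finset.card_image_le
      (f := fun b : Bool => fun w : Fin m => if w = x then tr b else if w = y then tr b else 2))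
    intro d hd
    obtain ⟨c, hcX, rfl⟩ := Finset.mem_image.1 hd
    rw [Finset.mem_filter] at hcX
    have hsub := hcX.2
    have g : ∀ w ∈ ({x, y} : Finset (Fin m)), ∃ b, c w = tr b := by
      intro w hw
      have := hsub hw
      apply exists_tr
      simpa [supp] using this
    obtain ⟨b1, h1⟩ := g x (by simp)
    obtain ⟨b2, h2⟩ := g y (by simp)
    have hb : b2 = b1 := by
      by_contra hne
      apply hc c hcX.1 b1
      refine ⟨h1, ?_⟩
      rw [h2]; congr 1; revert hne; cases b1 <;> cases b2 <;> simp
    subst hb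
    refine Finset.mem_image.2 ⟨b2, by simp, ?_⟩
    funext w
    by_cases wx : w = x
    · subst wx; simp [mask, h1]
    by_cases wy : w = y
    · subst wy; simp [mask, h2, wx]
    simp [mask, wx, wy]

/-- A transitive tournament on a nonempty finite set has a source. -/
lemma exists_source {α : Type*} [DecidableEq α] (R : α → α → Prop) (V : Finset α) (hV : V.Nonempty)
    (htot : ∀ x ∈ V, ∀ y ∈ V, x ≠ y → R x y ∨ R y x)
    (htr : ∀ x ∈ V, ∀ y ∈ V, ∀ z ∈ V, x ≠ y → y ≠ z → x ≠ z → R x y → R y z → R x z) :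
    ∃ s ∈ V, ∀ y ∈ V, y ≠ s → R s y := by
  induction hV using Finset.Nonempty.cons_induction with
  | singleton a => exact ⟨a, by simp, by simp⟩
  | cons x V hx hV ih =>
    obtain ⟨s, hs, hsy⟩ := ih
      (fun a ha b hb => htot a (Finset.mem_cons_of_mem ha) b (Finset.mem_cons_of_mem hb))
      (fun a ha b hb c hc => htr a (Finset.mem_cons_of_mem ha) b (Finset.mem_cons_of_mem hb) c
        (Finset.mem_cons_of_mem hc))
    have hxs : x ≠ s := fun h => hx (h ▸ hs)
    rcases htot x (Finset.mem_cons_self _ _) s (Finset.mem_cons_of_mem hs) hxs with h | h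
    · refine ⟨x, Finset.mem_cons_self _ _, ?_⟩
      intro y hy hyx
      rcases Finset.mem_cons.1 hy with rfl | hy'
      · exact absurd rfl hyx
      by_cases hys : y = s
      · subst hys; exact h
      exact htr x (Finset.mem_cons_self _ _) s (Finset.mem_cons_of_mem hs) y hy hxs (Ne.symm hys)
        (Ne.symm hyx) h (hsy y hy' hys)
    · refine ⟨s, Finset.mem_cons_of_mem hs, ?_⟩
      intro y hy hys
      rcases Finset.mem_cons.1 hy with rfl | hy'
      · exact h
      · exact hsy y hy' hys

lemma compat_trans (b : Bool) (r : Bool × Bool) (hr : r.1 ≠ r.2)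
    (h : ¬ (compat (b, !b) (b, !b) r).card ≤ 3) : r = (b, !b) := by
  revert b r; decide

lemma compat_eq (b : Bool) (q r : Bool × Bool) (hq : q.1 ≠ q.2) (hr : r.1 ≠ r.2)
    (h : ¬ (compat (b, b) q r).card ≤ 3) : q = (b, !b) ∧ r = (b, !b) := by
  obtain ⟨q1, q2⟩ := q
  obtain ⟨r1, r2⟩ := r
  revert hq hr h
  cases b <;> cases q1 <;> cases q2 <;> cases r1 <;> cases r2 <;> decide

lemma solo_force {m : ℕ} {P : Fin m → Fin m → Bool × Bool} {A : Finset (Fin m → Fin 3)}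
    {u v z : Fin m} {c : Fin m → Fin 3} (hc : c ∈ solo P A u v) (hzu : z ≠ u) (hzv : z ≠ v)
    (h1 : (P u z).1 = (P u v).1) (h2 : (P v z).1 = (P u v).2) (h3 : (P u z).2 ≠ (P v z).2) :
    c z = 2 := by
  rw [solo, Finset.mem_filter] at hc
  obtain ⟨_, ⟨hu, hv⟩, hs⟩ := hc
  by_contra hz
  obtain ⟨b, hb⟩ := exists_tr hz
  by_cases hbb : b = (P u z).2
  · rcases hs u z hzu.symm ⟨by rw [hu, h1], by rw [hb, hbb]⟩ with h | h
    · exact hzv h.2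
    · exact hzu h.2
  · have hb2 : b = (P v z).2 := by
      revert hbb h3; cases b <;> cases (P u z).2 <;> cases (P v z).2 <;> simp
    rcases hs v z hzv.symm ⟨by rw [hv, h2], by rw [hb, hb2]⟩ with h | h
    · exact hzv h.2
    · exact hzu h.2

lemma mixed_cases {p : Bool × Bool} (h : p.1 ≠ p.2) (b : Bool) : p = (b, !b) ∨ p = (!b, b) := by
  obtain ⟨p1, p2⟩ := p
  revert h; cases b <;> cases p1 <;> cases p2 <;> decide

/-- All triples being compatible, mixed patterns form transitive tournaments. -/
lemma source_P {m : ℕ} {P : Fin m → Fin m → Bool × Bool} (hS : SymP P) (V : Finset (Fin m))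
    (hV : V.Nonempty) (hmix : ∀ x ∈ V, ∀ y ∈ V, x ≠ y → (P x y).1 ≠ (P x y).2)
    (hg : ∀ x y z, x ≠ y → y ≠ z → x ≠ z → ¬ (compat (P x y) (P y z) (P x z)).card ≤ 3) (b : Bool) :
    ∃ s ∈ V, ∀ y ∈ V, y ≠ s → P s y = (b, !b) := by
  apply exists_source (fun x y => P x y = (b, !b)) V hV
  · intro x hx y hy hxy
    rcases mixed_cases (hmix x hx y hy hxy) b with h | h
    · exact Or.inl h
    · right
      rw [hS x y hxy, h]; rfl
  · intro x hx y hy z hz hxy hyz hxz h1 h2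
    have := hg x y z hxy hyz hxz
    rw [h1, h2] at this
    exact compat_trans b _ (hmix x hx z hz hxz) this

lemma upper_core {m : ℕ} (hm : 6 ≤ m) (A : Finset (Fin m → Fin 3))
    (h : ∀ i j, i ≠ j → ∃ p : Bool × Bool,
      cnt A i j (tr p.1) (tr p.2) ≤ if p.1 = p.2 then 2 else 3) :
    A.card + 2 ≤ 2 ^ m + m * 2 ^ (m - 1) + 3 * m.choose 2 := by
  classical
  obtain ⟨P, hS, hP⟩ := exists_symP (fun i j p => cnt A i j (tr p.1) (tr p.2) ≤
    if p.1 = p.2 then 2 else 3) h (by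
      intro i j p _ hp
      rw [cnt_swap]
      simpa [eq_comm] using hp)
  set t : Fin m → Fin m → ℕ := fun i j => if (P i j).1 = (P i j).2 then 2 else 3 with ht
  have hts : ∀ i j, i ≠ j → t i j = t j i := by
    intro i j hij
    simp only [ht, hS i j hij, Prod.fst_swap, Prod.snd_swap, eq_comm]
  have htv : ∀ i j, i ≠ j → (violSet P A i j).card ≤ t i j :=
    fun i j hij => (violSet_card P A i j).trans_le (hP i j hij)
  set D := (prs m).filter (fun q => (P q.1 q.2).1 = (P q.1 q.2).2) with hD
  have hsum : ∑ q ∈ prs m, t q.1 q.2 + D.card = 3 * m.choose 2 := by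
    rw [hD, Finset.card_filter, ← Finset.sum_add_distrib, ← card_prs, mul_comm, ← smul_eq_mul,
      ← Finset.sum_const]
    apply Finset.sum_congr rfl
    intro q _
    simp only [ht]
    split_ifs <;> rfl
  have hbad := bad_le hS A t htv
  have hbase := base_bound P (good P A) (good_viol P A)
  have hgb := good_bad P A
  rw [sum_base] at hbase
  by_cases hD2 : 2 ≤ D.card
  · omega
  by_cases hg : ∀ x y z, x ≠ y → y ≠ z → x ≠ z → ¬ (compat (P x y) (P y z) (P x z)).card ≤ 3
  swap
  · push Not at hg
    obtain ⟨x, y, z, hxy, hyz, hxz, hc⟩ := hg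
    have := triple_loss P (good P A) (good_viol P A) x y z hxy hyz hxz hc
    rw [sum_base] at this
    have h8 : 2 ^ 1 ≤ 2 ^ (m - 3) := Nat.pow_le_pow_right (by norm_num) (by omega)
    omega
  rcases Nat.eq_zero_or_pos D.card with hD0 | hDpos
  · -- all patterns are mixed
    have hmix : ∀ x y, x ≠ y → (P x y).1 ≠ (P x y).2 := by
      intro x y hxy he
      rw [Finset.card_eq_zero] at hD0
      have : ∀ q, q ∉ D := by rw [hD0]; simp
      rcases lt_or_gt_of_ne hxy with hl | hl
      · exact this (x, y) (by simp [hD, prs, hl, he])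
      · exact this (y, x) (by simp [hD, prs, hl, he, hS x y hxy])
    have hne : (univ : Finset (Fin m)).Nonempty := ⟨⟨0, by omega⟩, by simp⟩
    obtain ⟨u, _, hu⟩ := source_P hS univ hne (fun x _ y _ => hmix x y) hg true
    obtain ⟨v, _, hv⟩ := source_P hS univ hne (fun x _ y _ => hmix x y) hg false
    have huv : u ≠ v := by
      rintro rfl
      have : ∃ y : Fin m, y ≠ u := by
        by_cases h0 : u = ⟨0, by omega⟩
        · exact ⟨⟨1, by omega⟩, by rw [h0]; simp⟩
        · exact ⟨⟨0, by omega⟩, Ne.symm h0⟩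
      obtain ⟨y, hy⟩ := this
      have := (hu y (by simp) hy).symm.trans (hv y (by simp) hy)
      simp at this
    have hsolo : (solo P A u v).card ≤ 1 := by
      rw [Finset.card_le_one]
      intro c hc c' hc'
      funext z
      by_cases zu : z = u
      · subst zu
        rw [(Finset.mem_filter.1 hc).2.1.1, (Finset.mem_filter.1 hc').2.1.1]
      by_cases zv : z = v
      · subst zv
        rw [(Finset.mem_filter.1 hc).2.1.2, (Finset.mem_filter.1 hc').2.1.2]
      have e1 := hu z (by simp) zu
      have e2 := hv z (by simp) zv
      have e3 := hu v (by simp) huv.symm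
      rw [solo_force hc zu zv (by rw [e1, e3]) (by rw [e2, e3]; rfl) (by rw [e1, e2]; simp),
        solo_force hc' zu zv (by rw [e1, e3]) (by rw [e2, e3]; rfl) (by rw [e1, e2]; simp)]
    have := bad_le_solo hS A t hts htv u v huv
    have htuv : t u v = 3 := by simp [ht, hmix u v huv]
    omega
  · -- exactly one pattern is not mixed
    have hD1 : D.card = 1 := by omega
    obtain ⟨⟨i, j⟩, hij⟩ := Finset.card_eq_one.1 hD1
    have hmemD : (i, j) ∈ D := by rw [hij]; simp
    rw [hD, Finset.mem_filter] at hmemD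
    have hlt : i < j := by simpa [prs] using hmemD.1
    have hne : i ≠ j := hlt.ne
    have heq := hmemD.2
    simp only at heq
    have hmix : ∀ x y, x ≠ y → ¬ (x = i ∧ y = j) → ¬ (x = j ∧ y = i) → (P x y).1 ≠ (P x y).2 := by
      intro x y hxy n1 n2 he
      have : ∀ q, q ∈ D → q = (i, j) := by rw [hij]; simp
      rcases lt_or_gt_of_ne hxy with hl | hl
      · have := this (x, y) (by simp [hD, prs, hl, he])
        simp only [Prod.mk.injEq] at this
        exact n1 this
      · have := this (y, x) (by simp [hD, prs, hl, he, hS x y hxy])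
        simp only [Prod.mk.injEq] at this
        exact n2 this.symm
    obtain ⟨b, hb⟩ : ∃ b, P i j = (b, b) := ⟨(P i j).1, Prod.ext rfl heq.symm⟩
    have hz : ∀ z, z ≠ i → z ≠ j → P j z = (b, !b) ∧ P i z = (b, !b) := by
      intro z zi zj
      have := hg i j z hne zj.symm zi.symm
      rw [hb] at this
      exact compat_eq b _ _ (hmix j z zj.symm (fun h => hne h.1.symm) (fun h => zi h.2))
        (hmix i z zi.symm (fun h => zj h.2) (fun h => hne h.1)) this
    have hVne : ((univ.erase i).erase j : Finset (Fin m)).Nonempty := by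
      rw [← Finset.card_pos, Finset.card_erase_of_mem (by simp [hne.symm]),
        Finset.card_erase_of_mem (by simp), Finset.card_univ, Fintype.card_fin]
      omega
    obtain ⟨M, hM, hMs⟩ := source_P hS ((univ.erase i).erase j) hVne (by
      intro x hx y hy hxy
      simp only [Finset.mem_erase, Finset.mem_univ, and_true] at hx hy
      exact hmix x y hxy (fun h => hx.2 h.1) (fun h => hx.1 h.1)) hg (!b)
    simp only [Finset.mem_erase, Finset.mem_univ, and_true] at hM
    have hPiM := (hz M hM.2 hM.1).2
    have hPjM := (hz M hM.2 hM.1).1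
    have hsolo : (solo P A i M).card ≤ 2 := by
      have h2 : (univ : Finset Bool).card ≤ 2 := by simp
      refine le_trans ?_ h2
      refine le_trans (Finset.card_le_card ?_) (Finset.card_image_le
        (f := fun e : Bool => fun w : Fin m => if w = i then tr b else if w = M then tr (!b) else
          if w = j then (if e then tr (!b) else 2) else 2))
      intro c hc
      have hc' := (Finset.mem_filter.1 hc).2
      have hci : c i = tr b := by rw [hc'.1.1, hPiM]
      have hcM : c M = tr (!b) := by rw [hc'.1.2, hPiM]
      have hother : ∀ z, z ≠ i → z ≠ j → z ≠ M → c z = 2 := by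
        intro z zi zj zM
        have e1 := (hz z zi zj).2
        have e2 := hMs z (by simp [zi, zj]) zM
        apply solo_force hc zi zM
        · rw [e1, hPiM]
        · rw [e2, hPiM]
        · rw [e1, e2]; cases b <;> simp
      have hcj : c j = tr (!b) ∨ c j = 2 := by
        by_cases h2 : c j = 2
        · exact Or.inr h2
        left
        obtain ⟨e, he⟩ := exists_tr h2
        by_cases heb : e = b
        · exfalso
          subst heb
          rcases hc'.2 j M hM.1.symm ⟨by rw [he, hPjM], by rw [hcM, hPjM]⟩ with h | h
          · exact hne h.1.symm
          · exact hM.1 h.1.symm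
        · rw [he]; congr 1; revert heb; cases e <;> cases b <;> simp
      have hfin : ∀ e : Bool, c j = (if e then tr (!b) else 2) →
          (fun w : Fin m => if w = i then tr b else if w = M then tr (!b) else
          if w = j then (if e then tr (!b) else 2) else 2) = c := by
        intro e he
        funext w
        by_cases wi : w = i
        · subst wi; simp [hci]
        by_cases wM : w = M
        · subst wM; simp [wi, hcM]
        by_cases wj : w = j
        · subst wj; simp [wi, wM, he]
        simp [wi, wM, wj, hother w wi wj wM]
      rcases hcj with h | h
      · exact Finset.mem_image.2 ⟨true, by simp, hfin true (by simpa using h)⟩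
      · exact Finset.mem_image.2 ⟨false, by simp, hfin false (by simpa using h)⟩
    have := bad_le_solo hS A t hts htv i M hM.2.symm
    have htuv : t i M = 3 := by simp [ht, hPiM]
    omega

lemma choose_bound (m : ℕ) (hm : 6 ≤ m) : m.choose 2 + 1 ≤ m ^ 2 ∧ 2 ≤ 3 * m.choose 2 := by
  rw [Nat.choose_two_right]
  have h1 : m * (m - 1) + m = m ^ 2 := by
    obtain ⟨k, rfl⟩ : ∃ k, m = k + 1 := ⟨m - 1, by omega⟩
    simp; ring
  have h2 : 6 * 5 ≤ m * (m - 1) := Nat.mul_le_mul hm (by omega)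
  omega

lemma upper_F {m a b c d : ℕ} (hbc : min b c = 4) (had : max a d ≤ 3) (hm : 6 ≤ m)
    (h : (max b c - 1) * m ^ 2 ≤ 2 ^ (m - 2)) (A : Finset (Fin m → Fin 3))
    (hA : ¬ ConfigIn (Fabcd a b c d) A) :
    A.card + 2 ≤ 2 ^ m + m * 2 ^ (m - 1) + 3 * m.choose 2 := by
  classical
  rw [config_iff] at hA
  push Not at hA
  obtain ⟨M, hM⟩ : ∃ M, max b c - 1 = M := ⟨_, rfl⟩
  rw [hM] at h
  have hM3 : 3 ≤ M := by omega
  have key : ∀ i j, i ≠ j → (∃ p : Bool × Bool,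
      cnt A i j (tr p.1) (tr p.2) ≤ if p.1 = p.2 then 2 else 3) ∨
      (cnt A i j 1 0 ≤ M ∧ cnt A i j 0 1 ≤ M) := by
    intro i j hij
    have h1 := hA i j hij
    have h2 := hA j i hij.symm
    rw [cnt_swap A j i 0 0, cnt_swap A j i 1 0, cnt_swap A j i 0 1, cnt_swap A j i 1 1] at h2
    by_cases p1 : cnt A i j 0 0 ≤ 2
    · exact Or.inl ⟨(false, false), by simpa [tr] using p1⟩
    by_cases p2 : cnt A i j 1 1 ≤ 2
    · exact Or.inl ⟨(true, true), by simpa [tr] using p2⟩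
    by_cases p3 : cnt A i j 1 0 ≤ 3
    · exact Or.inl ⟨(true, false), by simpa [tr] using p3⟩
    by_cases p4 : cnt A i j 0 1 ≤ 3
    · exact Or.inl ⟨(false, true), by simpa [tr] using p4⟩
    right
    by_contra hcon
    rw [not_and_or] at hcon
    rcases hcon with hcon | hcon
    · rcases le_total b c with hb | hb
      · have := h2 (by omega) (by omega) (by omega); omega
      · have := h1 (by omega) (by omega) (by omega); omega
    · rcases le_total b c with hb | hb
      · have := h1 (by omega) (by omega) (by omega); omega
      · have := h2 (by omega) (by omega) (by omega); omega
  by_cases hcase : ∃ i j, i ≠ j ∧ cnt A i j 1 0 ≤ M ∧ cnt A i j 0 1 ≤ M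
  swap
  · push Not at hcase
    apply upper_core hm
    intro i j hij
    rcases key i j hij with h | h
    · exact h
    · exact absurd h.2 (by have := hcase i j hij h.1; omega)
  obtain ⟨i, j, hij, hc1, hc2⟩ := hcase
  obtain ⟨P, hS, hP⟩ := exists_symP (fun i j p => cnt A i j (tr p.1) (tr p.2) ≤ M) (by
    intro i j hij
    rcases key i j hij with ⟨p, hp⟩ | h
    · refine ⟨p, hp.trans ?_⟩
      split_ifs <;> omega
    · exact ⟨(true, false), h.1⟩) (by
    intro i j p _ hp
    rw [cnt_swap]; exact hp)
  have hbad := bad_le hS A (fun _ _ => M) (fun i j hij => (violSet_card P A i j).trans_le (hP i j hij))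
  rw [Finset.sum_const, card_prs, smul_eq_mul] at hbad
  have hgb := good_bad P A
  -- remove the remaining columns with different entries in rows `i`, `j`
  set X := (good P A).filter (fun c => ∀ b, ¬ (c i = tr b ∧ c j = tr (!b))) with hX
  have hXl := pair_loss P X (fun c hc => good_viol P A c (Finset.mem_filter.1 hc).1) i j hij
    (fun c hc => (Finset.mem_filter.1 hc).2)
  rw [sum_base] at hXl
  have hrest : (good P A).card ≤ X.card + 2 * M := by
    have hs : good P A ⊆ X ∪ (A.filter (fun x => x i = 1 ∧ x j = 0) ∪
        A.filter (fun x => x i = 0 ∧ x j = 1)) := by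
      intro c hc
      have hcA := (Finset.mem_filter.1 hc).1
      simp only [Finset.mem_union]
      by_cases hx : ∀ b, ¬ (c i = tr b ∧ c j = tr (!b))
      · exact Or.inl (Finset.mem_filter.2 ⟨hc, hx⟩)
      · push Not at hx
        obtain ⟨b, hb⟩ := hx
        right
        cases b
        · exact Or.inr (Finset.mem_filter.2 ⟨hcA, hb⟩)
        · exact Or.inl (Finset.mem_filter.2 ⟨hcA, hb⟩)
    have h1 := Finset.card_le_card hs
    have h2 := Finset.card_union_le X (A.filter (fun x => x i = 1 ∧ x j = 0) ∪
        A.filter (fun x => x i = 0 ∧ x j = 1))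
    have h3 := Finset.card_union_le (A.filter (fun x => x i = 1 ∧ x j = 0))
        (A.filter (fun x => x i = 0 ∧ x j = 1))
    unfold cnt at hc1 hc2
    omega
  have hch := choose_bound m hm
  have hch2 : m.choose 2 + 2 ≤ m ^ 2 := by
    rw [Nat.choose_two_right]
    have h1 : m * (m - 1) + m = m ^ 2 := by
      obtain ⟨k, rfl⟩ : ∃ k, m = k + 1 := ⟨m - 1, by omega⟩
      simp; ring
    omega
  have h5 : (m.choose 2 + 2) * M ≤ M * m ^ 2 := by
    rw [mul_comm M]; exact Nat.mul_le_mul_right M hch2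
  have h6 : (m.choose 2 + 2) * M = m.choose 2 * M + 2 * M := by ring
  omega

lemma lower_general {m : ℕ} (P : Fin m → Fin m → Bool × Bool)
    (Φ : Finset (Fin m) → Option (Fin m) → Fin m → Fin 3)
    (h2 : ∀ S o x, Φ S o x = 2 ↔ x ∉ S)
    (hinj : ∀ S : Finset (Fin m), ∀ o ∈ S.insertNone, ∀ o' ∈ S.insertNone, Φ S o = Φ S o' → o = o')
    (hΦ : ∀ S o i j, i ≠ j → ¬ Viol P (Φ S o) i j)
    {ι : Type} [DecidableEq ι] (I : Finset ι) (f : ι → Fin m → Fin 3)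
    (hf : ∀ x ∈ I, ∀ y ∈ I, f x = f y → x = y)
    (hv : ∀ x ∈ I, ∃ i j, i ≠ j ∧ Viol P (f x) i j)
    (hc : ∀ i j, i < j → (I.filter (fun x => Viol P (f x) i j)).card ≤ 3) :
    ∃ A : Finset (Fin m → Fin 3), 2 ^ m + m * 2 ^ (m - 1) + I.card ≤ A.card ∧
      ∀ i j, i < j → cnt A i j (tr (P i j).1) (tr (P i j).2) ≤ 3 := by
  classical
  set N := (univ.sigma (fun S : Finset (Fin m) => S.insertNone)).image (fun s => Φ s.1 s.2) with hN
  have hNcard : N.card = 2 ^ m + m * 2 ^ (m - 1) := by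
    rw [hN, Finset.card_image_of_injOn, Finset.card_sigma, ← sum_base]
    · simp only [Finset.card_insertNone]
    · rintro ⟨S, o⟩ hs ⟨S', o'⟩ hs' he
      simp only at he
      have e : S = S' := by
        ext x
        have a1 := h2 S o x
        have a2 := h2 S' o' x
        rw [he] at a1
        tauto
      subst e
      have := hinj S o (by simpa using hs) o' (by simpa using hs') he
      subst this; rfl
  have hNgood : ∀ c ∈ N, ∀ i j, i ≠ j → ¬ Viol P c i j := by
    intro c hc
    obtain ⟨s, _, rfl⟩ := Finset.mem_image.1 hc
    exact hΦ s.1 s.2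
  have hE : (I.image f).card = I.card :=
    Finset.card_image_of_injOn (fun x hx y hy h => hf x hx y hy h)
  have hdisj : Disjoint N (I.image f) := by
    rw [Finset.disjoint_left]
    intro c hcN hcE
    obtain ⟨x, hx, rfl⟩ := Finset.mem_image.1 hcE
    obtain ⟨i, j, hij, hvij⟩ := hv x hx
    exact hNgood _ hcN i j hij hvij
  refine ⟨N ∪ I.image f, ?_, ?_⟩
  · rw [Finset.card_union_of_disjoint hdisj, hNcard, hE]
  · intro i j hij
    refine le_trans ?_ (hc i j hij)
    refine le_trans (Finset.card_le_card ?_) (Finset.card_image_le (f := f))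
    intro c hcm
    rw [Finset.mem_filter, Finset.mem_union] at hcm
    rcases hcm.1 with h | h
    · exact absurd hcm.2 (hNgood c h i j hij.ne)
    · obtain ⟨x, hx, rfl⟩ := Finset.mem_image.1 h
      exact Finset.mem_image.2 ⟨x, Finset.mem_filter.2 ⟨hx, hcm.2⟩, rfl⟩

/-- Base columns for `K`. -/
def phiK {m : ℕ} (S : Finset (Fin m)) (o : Option (Fin m)) (x : Fin m) : Fin 3 :=
  if x ∉ S then 2 else if o = some x then 1 else 0

/-- Base columns for `I`. -/
def phiI {m : ℕ} (S : Finset (Fin m)) (o : Option (Fin m)) (x : Fin m) : Fin 3 :=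
  if x ∉ S then 2 else if (∃ i, o = some i ∧ i ≤ x) then 1 else 0

/-- Build a column from its ones and zeros. -/
noncomputable def colOf {m : ℕ} (One Zero : ℕ → Prop) (x : Fin m) : Fin 3 :=
  open Classical in if One x then 1 else if Zero x then 0 else 2

lemma colOf_one {m : ℕ} (One Zero : ℕ → Prop) (x : Fin m) : colOf One Zero x = 1 ↔ One x := by
  unfold colOf; split_ifs <;> simp_all

lemma colOf_zero {m : ℕ} (One Zero : ℕ → Prop) (x : Fin m) (h : One x → ¬ Zero x) :
    colOf One Zero x = 0 ↔ Zero x := by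
  unfold colOf; split_ifs <;> simp_all

def oneK (i j x : ℕ) : Prop := x = i ∨ x = j
def zeroK (i j k x : ℕ) : Prop := x ≠ i ∧ x ≠ j ∧ (k = 0 ∨ (k = 2 ∧ 3 ≤ x))

lemma injK {m i j k i' j' k' : ℕ} (hm : 6 ≤ m) (hij : i < j) (hj : j < m) (hij' : i' < j')
    (hj' : j' < m) (hk : k < 3) (hk' : k' < 3)
    (h1 : ∀ x, x < m → (oneK i j x ↔ oneK i' j' x))
    (h0 : ∀ x, x < m → (zeroK i j k x ↔ zeroK i' j' k' x)) : i = i' ∧ j = j' ∧ k = k' := by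
  unfold oneK at h1
  unfold zeroK at h0
  have a1 := h1 i (by omega)
  have a2 := h1 j (by omega)
  have a3 := h1 i' (by omega)
  have a4 := h1 j' (by omega)
  have ei : i = i' := by omega
  have ej : j = j' := by omega
  refine ⟨ei, ej, ?_⟩
  obtain ⟨x, hx, hxi, hxj⟩ : ∃ x, x < 3 ∧ x ≠ i ∧ x ≠ j := by
    by_cases 0 = i ∨ 0 = j
    · by_cases 1 = i ∨ 1 = j
      · exact ⟨2, by omega⟩
      · exact ⟨1, by omega⟩
    · exact ⟨0, by omega⟩
  obtain ⟨y, hy, hy3, hyi, hyj⟩ : ∃ x, x < 6 ∧ 3 ≤ x ∧ x ≠ i ∧ x ≠ j := by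
    by_cases 3 = i ∨ 3 = j
    · by_cases 4 = i ∨ 4 = j
      · exact ⟨5, by omega⟩
      · exact ⟨4, by omega⟩
    · exact ⟨3, by omega⟩
  have b1 := h0 x (by omega)
  have b2 := h0 y (by omega)
  subst ei ej
  simp only [ne_eq, hxi, hxj, hyi, hyj, not_false_eq_true, true_and, hy3, and_true,
    show ¬ 3 ≤ x by omega, and_false, or_false] at b1 b2
  omega

lemma lower_K {m : ℕ} (hm : 6 ≤ m) : ∃ A : Finset (Fin m → Fin 3), ¬ ConfigIn (pK2 4) A ∧
    2 ^ m + m * 2 ^ (m - 1) + 3 * m.choose 2 ≤ A.card := by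
  classical
  obtain ⟨A, hA, hcnt⟩ := lower_general (m := m) (fun _ _ => (true, true)) phiK
    (by intro S o x; unfold phiK; split_ifs <;> simp_all)
    (by
      intro S o ho o' ho' he
      have key : ∀ i ∈ S, (o = some i ↔ o' = some i) := by
        intro i hi
        have := congrFun he i
        unfold phiK at this
        simp only [hi, not_true_eq_false, if_false] at this
        split_ifs at this <;> simp_all
      cases o with
      | none =>
        cases o' with
        | none => rfl
        | some i => exact (key i (by simpa using ho')).2 rfl
      | some i => exact ((key i (by simpa using ho)).1 rfl).symm)
    (by
      rintro S o i j hij ⟨h1, h2⟩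
      have e : tr true = 1 := rfl
      simp only [phiK, e] at h1 h2
      split_ifs at h1 h2 <;> simp_all)
    ((prs m) ×ˢ (univ : Finset (Fin 3)))
    (fun q => colOf (oneK q.1.1 q.1.2) (zeroK q.1.1 q.1.2 q.2))
    (by
      rintro ⟨⟨i, j⟩, k⟩ hx ⟨⟨i', j'⟩, k'⟩ hy he
      have hij : i < j := by simpa [prs] using hx
      have hij' : i' < j' := by simpa [prs] using hy
      simp only at he
      have := injK (k := k) (k' := k') hm hij j.2 hij' j'.2 k.2 k'.2 (by
        intro x hx
        have := congrFun he ⟨x, hx⟩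
        rw [← colOf_one (oneK i j) (zeroK i j k) ⟨x, hx⟩, this, colOf_one]) (by
        intro x hx
        have := congrFun he ⟨x, hx⟩
        rw [← colOf_zero (oneK i j) (zeroK i j k) ⟨x, hx⟩, this, colOf_zero]
        · unfold oneK zeroK; simp only; omega
        · unfold oneK zeroK; simp only; omega)
      simp only [Prod.mk.injEq, Fin.ext_iff]
      omega)
    (by
      rintro ⟨⟨i, j⟩, k⟩ hx
      have hij : i < j := by simpa [prs] using hx
      exact ⟨i, j, hij.ne, (colOf_one _ _ _).2 (Or.inl rfl), (colOf_one _ _ _).2 (Or.inr rfl)⟩)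
    (by
      intro i j hij
      have : ((univ : Finset (Fin 3)).image (fun k => ((i, j), k))).card ≤ 3 :=
        Finset.card_image_le.trans (by simp)
      refine le_trans (Finset.card_le_card ?_) this
      rintro ⟨⟨i', j'⟩, k⟩ hx
      rw [Finset.mem_filter] at hx
      have hij' : i' < j' := by simpa [prs] using hx.1
      have a1 : oneK i' j' i := (colOf_one _ _ _).1 hx.2.1
      have a2 : oneK i' j' j := (colOf_one _ _ _).1 hx.2.2
      unfold oneK at a1 a2
      have hl : i.val < j.val := hij
      have hl' : i'.val < j'.val := hij'
      have e1 : i.val = i'.val := by omega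
      have e2 : j.val = j'.val := by omega
      rw [← Fin.ext_iff] at e1 e2
      exact Finset.mem_image.2 ⟨k, by simp, by rw [e1, e2]⟩)
  refine ⟨A, ?_, ?_⟩
  · rw [pK2, config_iff]
    rintro ⟨i, j, hij, _, _, _, h⟩
    rcases lt_or_gt_of_ne hij with hl | hl
    · have : cnt A i j 1 1 ≤ 3 := hcnt i j hl
      omega
    · have : cnt A j i 1 1 ≤ 3 := hcnt j i hl
      rw [cnt_swap] at this
      omega
  · rw [Finset.card_product, card_prs, Finset.card_univ, Fintype.card_fin] at hA
    omega

def oneI (m i j k x : ℕ) : Prop := x = i ∨ (j < x ∧ (k = 0 ∨ (k = 2 ∧ i = 0 ∧ x + 1 = m ∧ j + 2 ≠ m))) ∨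
  (x < i ∧ k = 2 ∧ x = 0 ∧ i = 1 ∧ j + 1 = m)
def zeroI (m i j k x : ℕ) : Prop := x = j ∨ (x < i ∧ (k = 0 ∨ (k = 2 ∧ x = 0 ∧ ¬ (i = 1 ∧ j + 1 = m)))) ∨
  (j < x ∧ k = 2 ∧ i = 0 ∧ x + 1 = m ∧ j + 2 = m)

lemma disjI {m i j k x : ℕ} (hij : i < j) : oneI m i j k x → ¬ zeroI m i j k x := by
  unfold oneI zeroI; omega

lemma violI {m i j k u v : ℕ} (hij : i < j) (hj : j < m) (huv : u < v) (hv : v < m)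
    (h1 : oneI m i j k u) (h0 : zeroI m i j k v) : (u = i ∧ v = j) ∨
      (k = 2 ∧ ((i = 0 ∧ j + 2 = m) ∨ (i = 1 ∧ j + 1 = m)) ∧ u = 0 ∧ v + 1 = m) := by
  unfold oneI at h1
  unfold zeroI at h0
  omega

lemma injI_aux1 {m i j k k' : ℕ} (hm : 6 ≤ m) (hij : i < j) (hj : j < m) (hk : k = 1)
    (hkk : k' ≠ 1) (hk' : k' < 3) (hx' : i = 0 → j + 1 = m → k' = 1)
    (h1 : ∀ x, x < m → (oneI m i j k x ↔ oneI m i j k' x))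
    (h0 : ∀ x, x < m → (zeroI m i j k x ↔ zeroI m i j k' x)) : False := by
  subst hk
  have two : ∀ x, x < m → x ≠ i → x ≠ j → ¬ oneI m i j k' x ∧ ¬ zeroI m i j k' x := by
    intro x hx a b
    rw [← h1 x hx, ← h0 x hx]
    unfold oneI zeroI
    omega
  by_cases hi : i = 0
  · have := two (m - 1) (by omega) (by omega) (by omega)
    unfold oneI zeroI at this
    omega
  · have := two 0 (by omega) (by omega) (by omega)
    unfold oneI zeroI at this
    omega

lemma injI_aux2 {m i j k k' : ℕ} (hm : 6 ≤ m) (hij : i < j) (hj : j < m) (hk : k = 0)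
    (hk' : k' = 2) (hx : i = 0 → j + 1 = m → k = 1)
    (h1 : ∀ x, x < m → (oneI m i j k x ↔ oneI m i j k' x))
    (h0 : ∀ x, x < m → (zeroI m i j k x ↔ zeroI m i j k' x)) : False := by
  subst hk hk'
  by_cases hi : i = 0
  · by_cases hj2 : j + 2 = m
    · have a : oneI m i j 0 (m - 1) := by unfold oneI; omega
      have b := (h1 (m - 1) (by omega)).1 a
      unfold oneI at b
      omega
    · have a : oneI m i j 0 (m - 2) := by unfold oneI; omega
      have b := (h1 (m - 2) (by omega)).1 a
      unfold oneI at b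
      omega
  · by_cases hi1 : i = 1
    · by_cases hj1 : j + 1 = m
      · have a : zeroI m i j 0 0 := by unfold zeroI; omega
        have b := (h0 0 (by omega)).1 a
        unfold zeroI at b
        omega
      · have a : oneI m i j 0 (m - 1) := by unfold oneI; omega
        have b := (h1 (m - 1) (by omega)).1 a
        unfold oneI at b
        omega
    · have a : zeroI m i j 0 1 := by unfold zeroI; omega
      have b := (h0 1 (by omega)).1 a
      unfold zeroI at b
      omega

lemma injI {m i j k i' j' k' : ℕ} (hm : 6 ≤ m) (hij : i < j) (hj : j < m) (hij' : i' < j')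
    (hj' : j' < m) (hk : k < 3) (hk' : k' < 3)
    (hx : i = 0 → j + 1 = m → k = 1) (hx' : i' = 0 → j' + 1 = m → k' = 1)
    (h1 : ∀ x, x < m → (oneI m i j k x ↔ oneI m i' j' k' x))
    (h0 : ∀ x, x < m → (zeroI m i j k x ↔ zeroI m i' j' k' x)) : i = i' ∧ j = j' ∧ k = k' := by
  have a1 := violI hij' hj' hij hj ((h1 i (by omega)).1 (Or.inl rfl)) ((h0 j hj).1 (Or.inl rfl))
  have a2 := violI hij hj hij' hj' ((h1 i' (by omega)).2 (Or.inl rfl))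
    ((h0 j' hj').2 (Or.inl rfl))
  have ei : i = i' := by omega
  have ej : j = j' := by omega
  refine ⟨ei, ej, ?_⟩
  subst ei ej
  by_contra hkk
  by_cases k1 : k = 1
  · exact injI_aux1 hm hij hj k1 (Ne.symm fun h => hkk (k1.trans h)) hk' hx' h1 h0
  by_cases k1' : k' = 1
  · exact injI_aux1 hm hij hj k1' k1 hk hx (fun x h => (h1 x h).symm) (fun x h => (h0 x h).symm)
  by_cases k0 : k = 0
  · exact injI_aux2 hm hij hj k0 (by omega) hx h1 h0
  · exact injI_aux2 hm hij hj (by omega) (by omega) hx' (fun x h => (h1 x h).symm)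
      (fun x h => (h0 x h).symm)

/-- the pattern assignment of the linear order -/
def PI (m : ℕ) (i j : Fin m) : Bool × Bool := if i < j then (true, false) else (false, true)

lemma viol_PI {m : ℕ} {c : Fin m → Fin 3} {i j : Fin m} (h : i < j) :
    Viol (PI m) c i j ↔ c i = 1 ∧ c j = 0 := by
  unfold Viol PI; rw [if_pos h]; rfl

lemma viol_PI' {m : ℕ} {c : Fin m → Fin 3} {i j : Fin m} (h : j < i) :
    Viol (PI m) c i j ↔ c j = 1 ∧ c i = 0 := by
  unfold Viol PI; rw [if_neg h.not_gt, and_comm]; rfl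

lemma phiI_nv {m : ℕ} (S : Finset (Fin m)) (o : Option (Fin m)) (i j : Fin m) (h : i < j) :
    ¬ (phiI S o i = 1 ∧ phiI S o j = 0) := by
  rintro ⟨h1, h2⟩
  unfold phiI at h1 h2
  by_cases a2 : ∃ w, o = some w ∧ w ≤ i
  · obtain ⟨w, hw, hwi⟩ := a2
    rw [if_pos (⟨w, hw, hwi.trans h.le⟩ : ∃ w, o = some w ∧ w ≤ j)] at h2
    split_ifs at h2
    · simp at h2
    · simp at h2
  · rw [if_neg a2] at h1
    split_ifs at h1
    · simp at h1
    · simp at h1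

lemma lower_I {m : ℕ} (hm : 6 ≤ m) : ∃ A : Finset (Fin m → Fin 3),
    2 ^ m + m * 2 ^ (m - 1) + 3 * m.choose 2 ≤ A.card + 2 ∧
    ∀ i j, i ≠ j → cnt A i j 1 0 ≤ 3 ∨ cnt A i j 0 1 ≤ 3 := by
  classical
  let z : Fin m := ⟨0, by omega⟩
  let l : Fin m := ⟨m - 1, by omega⟩
  let I : Finset ((Fin m × Fin m) × Fin 3) :=
    (((prs m) ×ˢ (univ : Finset (Fin 3))).erase ((z, l), 0)).erase ((z, l), 2)
  have hI : ∀ i j k, ((i, j), k) ∈ I → i < j ∧ (i.val = 0 → j.val + 1 = m → k.val = 1) := by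
    intro i j k h
    simp only [I, Finset.mem_erase, Finset.mem_product, prs, Finset.mem_filter, Finset.mem_univ,
      true_and, and_true, Prod.mk.injEq, z, l, Fin.ext_iff, ne_eq] at h
    refine ⟨h.2.2, ?_⟩
    intro h1 h2
    have h3 := h.1
    have h4 := h.2.1
    have e0 : ((0 : Fin 3) : ℕ) = 0 := rfl
    have e2 : ((2 : Fin 3) : ℕ) = 2 := rfl
    rw [e2] at h3
    rw [e0] at h4
    have := k.2
    omega
  obtain ⟨A, hA, hcnt⟩ := lower_general (m := m) (PI m) phiI
    (by intro S o x; unfold phiI; split_ifs <;> simp_all)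
    (by
      intro S o ho o' ho' he
      have key : ∀ x ∈ S, ((∃ i, o = some i ∧ i ≤ x) ↔ (∃ i, o' = some i ∧ i ≤ x)) := by
        intro x hx
        have := congrFun he x
        unfold phiI at this
        simp only [hx, not_true_eq_false, if_false] at this
        split_ifs at this with p q q
        · exact ⟨fun _ => q, fun _ => p⟩
        · simp at this
        · simp at this
        · exact ⟨fun h => absurd h p, fun h => absurd h q⟩
      cases o with
      | none =>
        cases o' with
        | none => rfl
        | some i => simpa using (key i (by simpa using ho')).2 ⟨i, rfl, le_refl _⟩
      | some i =>
        cases o' with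
        | none => simpa using (key i (by simpa using ho)).1 ⟨i, rfl, le_refl _⟩
        | some j =>
          have k1 := (key i (by simpa using ho)).1 ⟨i, rfl, le_refl _⟩
          have k2 := (key j (by simpa using ho')).2 ⟨j, rfl, le_refl _⟩
          simp only [Option.some.injEq, exists_eq_left'] at k1 k2
          rw [le_antisymm k2 k1])
    (by
      intro S o i j hij
      rcases lt_or_gt_of_ne hij with hl | hl
      · rw [viol_PI hl]; exact phiI_nv S o i j hl
      · rw [viol_PI' hl]; exact phiI_nv S o j i hl)
    I
    (fun q => colOf (oneI m q.1.1 q.1.2 q.2) (zeroI m q.1.1 q.1.2 q.2))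
    (by
      rintro ⟨⟨i, j⟩, k⟩ hx ⟨⟨i', j'⟩, k'⟩ hy he
      obtain ⟨hij, hex⟩ := hI _ _ _ hx
      obtain ⟨hij', hex'⟩ := hI _ _ _ hy
      simp only at he
      have := injI (k := k) (k' := k') hm hij j.2 hij' j'.2 k.2 k'.2 hex hex' (by
        intro x hx
        have := congrFun he ⟨x, hx⟩
        rw [← colOf_one (oneI m i j k) (zeroI m i j k) ⟨x, hx⟩, this, colOf_one]) (by
        intro x hx
        have := congrFun he ⟨x, hx⟩
        rw [← colOf_zero (oneI m i j k) (zeroI m i j k) ⟨x, hx⟩ (disjI hij), this,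
          colOf_zero _ _ _ (disjI hij')])
      simp only [Prod.mk.injEq, Fin.ext_iff]
      omega)
    (by
      rintro ⟨⟨i, j⟩, k⟩ hx
      obtain ⟨hij, hex⟩ := hI _ _ _ hx
      refine ⟨i, j, hij.ne, ?_⟩
      rw [viol_PI hij]
      exact ⟨(colOf_one _ _ _).2 (Or.inl rfl), (colOf_zero _ _ _ (disjI hij)).2 (Or.inl rfl)⟩)
    (by
      intro u v huv
      have step : ∀ i j k, ((i, j), k) ∈ I →
          Viol (PI m) (colOf (oneI m i j k) (zeroI m i j k)) u v →
          (u = i ∧ v = j) ∨ (k.val = 2 ∧ ((i.val = 0 ∧ j.val + 2 = m) ∨ (i.val = 1 ∧ j.val + 1 = m)) ∧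
            u.val = 0 ∧ v.val + 1 = m) := by
        intro i j k hx hvi
        obtain ⟨hij, hex⟩ := hI _ _ _ hx
        rw [viol_PI huv] at hvi
        have := violI hij j.2 huv v.2 ((colOf_one _ _ _).1 hvi.1)
          ((colOf_zero _ _ _ (disjI hij)).1 hvi.2)
        simpa only [Fin.ext_iff] using this
      by_cases hsp : u.val = 0 ∧ v.val + 1 = m
      · have : ({((z, l), 1), ((z, ⟨m - 2, by omega⟩), 2), ((⟨1, by omega⟩, l), 2)} :
            Finset ((Fin m × Fin m) × Fin 3)).card ≤ 3 := Finset.card_le_three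
        refine le_trans (Finset.card_le_card ?_) this
        rintro ⟨⟨i, j⟩, k⟩ hx
        rw [Finset.mem_filter] at hx
        obtain ⟨hij, hex⟩ := hI _ _ _ hx.1
        have hs := step i j k hx.1 hx.2
        have e1 : ((1 : Fin 3) : ℕ) = 1 := rfl
        have e2 : ((2 : Fin 3) : ℕ) = 2 := rfl
        simp only [Finset.mem_insert, Finset.mem_singleton, Prod.mk.injEq, Fin.ext_iff, z, l, e1, e2]
        simp only [Fin.ext_iff] at hs
        omega
      · have : ((univ : Finset (Fin 3)).image (fun k => ((u, v), k))).card ≤ 3 :=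
          Finset.card_image_le.trans (by simp)
        refine le_trans (Finset.card_le_card ?_) this
        rintro ⟨⟨i, j⟩, k⟩ hx
        rw [Finset.mem_filter] at hx
        refine Finset.mem_image.2 ⟨k, by simp, ?_⟩
        rcases step i j k hx.1 hx.2 with h | h
        · rw [h.1, h.2]
        · exact absurd h.2.2 hsp)
  refine ⟨A, ?_, ?_⟩
  · have : I.card + 2 ≥ 3 * m.choose 2 := by
      have e1 := Finset.pred_card_le_card_erase (s := (prs m) ×ˢ (univ : Finset (Fin 3)))
        (a := ((z, l), 0))
      have e2 := Finset.pred_card_le_card_erase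
        (s := ((prs m) ×ˢ (univ : Finset (Fin 3))).erase ((z, l), 0)) (a := ((z, l), 2))
      rw [Finset.card_product, card_prs, Finset.card_univ, Fintype.card_fin] at e1
      simp only [I]
      omega
    omega
  · intro i j hij
    rcases lt_or_gt_of_ne hij with hl | hl
    · left
      have := hcnt i j hl
      rw [PI, if_pos hl] at this
      exact this
    · right
      have := hcnt j i hl
      rw [PI, if_pos hl, cnt_swap] at this
      exact this

lemma forb_F {m a b c d : ℕ} (hbc : min b c = 4) (had : max a d ≤ 3) (hm : 6 ≤ m)
    (h : (max b c - 1) * m ^ 2 ≤ 2 ^ (m - 2)) :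
    forb m 3 (Fabcd a b c d) = 2 ^ m + m * 2 ^ (m - 1) + 3 * m.choose 2 - 2 := by
  apply forb_eq
  · intro A hA
    have := upper_F hbc had hm h A hA
    omega
  · obtain ⟨A, hA, hc⟩ := lower_I hm
    refine ⟨A, ?_, by omega⟩
    rw [config_iff]
    rintro ⟨i, j, hij, _, h1, h2, _⟩
    have := hc i j hij
    omega

lemma forb_K {m : ℕ} (hm : 6 ≤ m) :
    forb m 3 (pK2 4) = 2 ^ m + m * 2 ^ (m - 1) + 3 * m.choose 2 :=
  forb_eq _ upper_K (lower_K hm)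

end ForbP4

theorem forb_p4 (m a b c d : ℕ) (hbc : min b c = 4) (had : max a d ≤ 3) (hm : 6 ≤ m)
    (h : (max b c - 1) * m ^ 2 ≤ 2 ^ (m - 2)) :
    forb m 3 (Fabcd a b c d) = forb m 3 (pI2 4) ∧
    forb m 3 (Fabcd a b c d) = forb m 3 (pK2 4) - 2 ∧
    forb m 3 (Fabcd a b c d) = 2 ^ m + m * 2 ^ (m - 1) + 3 * Nat.choose m 2 - 2 := by
  have h1 := ForbP4.forb_F hbc had hm h
  have h2 : forb m 3 (pI2 4) = _ := ForbP4.forb_F (a := 0) (b := 4) (c := 4) (d := 0) (by simp)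
    (by simp) hm (le_trans (Nat.mul_le_mul_right _ (by omega)) h)
  have h3 := ForbP4.forb_K hm
  exact ⟨by rw [h1, h2], by rw [h1, h3], h1⟩
end

section
/- For every p ≥ 2, every 0 ≤ q ≤ p−1, with r = ⌈log₂(p−1)⌉ and N_r = binom(⌈r/2⌉+1,2) + binom(⌊r/2⌋+1,2), and every m ≥ 2N_r + 2: forb(m, 3, F(p−q, p, p, p−q)) ≥ forb(m, 3, p·K_2) − q·N_r = 2^m + m·2^(m−1) + (p−1)·binom(m,2) − q·N_r. -/
open Finset

/-! ### Basic facts on configurations -/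

theorem count_Fabcd (a b c d : ℕ) (x : Fin 2 → Fin 3) :
    Multiset.count x (Fabcd a b c d) =
      (if ![0, 0] = x then a else 0) + (if ![1, 0] = x then b else 0) +
      (if ![0, 1] = x then c else 0) + (if ![1, 1] = x then d else 0) := by
  simp only [Fabcd, Multiset.count_add, Multiset.count_replicate]

theorem count_cols {m : ℕ} (A : Finset (Fin m → Fin 3)) (ρ : Fin 2 ↪ Fin m) (a b : Fin 3) :
    Multiset.count ![a, b] (A.1.map (fun col => col ∘ ρ)) =
      (A.filter (fun c => c (ρ 0) = a ∧ c (ρ 1) = b)).card := by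
  rw [Multiset.count_map, Finset.card_def, Finset.filter_val]
  congr 1
  apply Multiset.filter_congr
  intro c _
  constructor
  · intro h
    have h0 := congrFun h 0
    have h1 := congrFun h 1
    simp at h0 h1
    exact ⟨h0.symm, h1.symm⟩
  · rintro ⟨h0, h1⟩
    funext k
    fin_cases k
    · simp [h0]
    · simp [h1]

theorem forb_bdd (m : ℕ) (F : Multiset (Fin 2 → Fin 3)) :
    BddAbove {n : ℕ | ∃ A : Finset (Fin m → Fin 3), ¬ ConfigIn F A ∧ A.card = n} := by
  refine ⟨Fintype.card (Fin m → Fin 3), ?_⟩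
  rintro n ⟨A, _, rfl⟩
  exact Finset.card_le_univ A

theorem le_forb (m : ℕ) (F : Multiset (Fin 2 → Fin 3)) (A : Finset (Fin m → Fin 3))
    (h : ¬ ConfigIn F A) : A.card ≤ forb m 3 F :=
  le_csSup (forb_bdd m F) ⟨A, h, rfl⟩

/-! ### The upper bound for `p K₂` -/

theorem card_cons {m : ℕ} (A : Finset (Fin (m + 1) → Fin 3)) :
    A.card = (univ.filter (fun t : Fin m → Fin 3 => Fin.cons (0 : Fin 3) t ∈ A)).card
      + (univ.filter (fun t : Fin m → Fin 3 => Fin.cons (1 : Fin 3) t ∈ A)).card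
      + (univ.filter (fun t : Fin m → Fin 3 => Fin.cons (2 : Fin 3) t ∈ A)).card := by
  have key : ∀ a : Fin 3, (univ.filter
      (fun t : Fin m → Fin 3 => (Fin.cons a t : Fin (m + 1) → Fin 3) ∈ A)).card
      = (A.filter (fun c => c 0 = a)).card := by
    intro a
    apply Finset.card_bij (fun t _ => (Fin.cons a t : Fin (m + 1) → Fin 3))
    · intro t ht
      simp at ht ⊢
      exact ht
    · intro t _ t' _ h
      exact Fin.cons_right_injective (α := fun _ => Fin 3) a h
    · intro c hc
      simp only [mem_filter] at hc
      have e : (Fin.cons a (Fin.tail c) : Fin (m + 1) → Fin 3) = c := by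
        rw [← hc.2]; exact Fin.cons_self_tail c
      refine ⟨Fin.tail c, ?_, e⟩
      simp only [mem_filter, mem_univ, true_and]
      rw [e]; exact hc.1
  rw [key, key, key]
  have := Finset.card_eq_sum_card_fiberwise (s := A) (t := (univ : Finset (Fin 3)))
    (f := fun c => c 0) (by intro x _; simp)
  rw [this, Fin.sum_univ_three]

theorem card_noK1 (m : ℕ) (A : Finset (Fin m → Fin 3))
    (h : ∀ i, ∃ a : Fin 3, a ≠ 2 ∧ ∀ c ∈ A, c i ≠ a) : A.card ≤ 2 ^ m := by
  induction m with
  | zero =>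
    calc A.card ≤ Fintype.card (Fin 0 → Fin 3) := Finset.card_le_univ A
      _ = 2 ^ 0 := by simp
  | succ m ih =>
    have hb : ∀ a : Fin 3, (univ.filter
        (fun t : Fin m → Fin 3 => (Fin.cons a t : Fin (m + 1) → Fin 3) ∈ A)).card ≤ 2 ^ m := by
      intro a
      apply ih
      intro i
      obtain ⟨b, hb, hc⟩ := h i.succ
      refine ⟨b, hb, ?_⟩
      intro c hcm
      simp only [mem_filter, mem_univ, true_and] at hcm
      have := hc _ hcm
      simpa using this
    rw [card_cons A, pow_succ]
    obtain ⟨a, ha, hc⟩ := h 0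
    have hz : (univ.filter
        (fun t : Fin m → Fin 3 => (Fin.cons a t : Fin (m + 1) → Fin 3) ∈ A)).card = 0 := by
      rw [Finset.card_eq_zero, Finset.filter_eq_empty_iff]
      intro t _ ht
      exact hc _ ht (by simp)
    have h0 := hb 0
    have h1 := hb 1
    have h2 := hb 2
    fin_cases a
    · simp only [Fin.zero_eta] at hz
      omega
    · simp only [Fin.mk_one] at hz
      omega
    · exact absurd rfl ha

theorem card_noK2 (m : ℕ) (A : Finset (Fin m → Fin 3))
    (h : ∀ i j, i < j → ∃ a b : Fin 3, a ≠ 2 ∧ b ≠ 2 ∧ ∀ c ∈ A, ¬ (c i = a ∧ c j = b)) :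
    A.card ≤ 2 ^ m + m * 2 ^ (m - 1) := by
  induction m with
  | zero =>
    calc A.card ≤ Fintype.card (Fin 0 → Fin 3) := Finset.card_le_univ A
      _ = _ := by simp
  | succ m ih =>
    set Bf : Fin 3 → Finset (Fin m → Fin 3) := fun a => univ.filter
        (fun t : Fin m → Fin 3 => (Fin.cons a t : Fin (m + 1) → Fin 3) ∈ A) with hBf
    have memB : ∀ a t, t ∈ Bf a ↔ (Fin.cons a t : Fin (m + 1) → Fin 3) ∈ A := by
      intro a t; simp [hBf]
    have h2 : (Bf 2).card ≤ 2 ^ m + m * 2 ^ (m - 1) := by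
      apply ih
      intro i j hij
      obtain ⟨a, b, ha, hb, hc⟩ := h i.succ j.succ (by simpa using hij)
      refine ⟨a, b, ha, hb, ?_⟩
      intro c hcm
      have := hc _ ((memB _ _).1 hcm)
      simpa using this
    have h01 : (Bf 0 ∪ Bf 1).card ≤ 2 ^ m + m * 2 ^ (m - 1) := by
      apply ih
      intro i j hij
      obtain ⟨a, b, ha, hb, hc⟩ := h i.succ j.succ (by simpa using hij)
      refine ⟨a, b, ha, hb, ?_⟩
      intro c hcm
      rw [Finset.mem_union] at hcm
      rcases hcm with hcm | hcm
      · have := hc _ ((memB _ _).1 hcm)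
        simpa using this
      · have := hc _ ((memB _ _).1 hcm)
        simpa using this
    have hi : (Bf 0 ∩ Bf 1).card ≤ 2 ^ m := by
      apply card_noK1
      intro i
      obtain ⟨a, b, ha, hb, hc⟩ := h 0 i.succ (Fin.succ_pos i)
      refine ⟨b, hb, ?_⟩
      intro c hcm hcb
      rw [Finset.mem_inter] at hcm
      have hca : (Fin.cons a c : Fin (m + 1) → Fin 3) ∈ A := by
        fin_cases a
        · exact (memB _ _).1 hcm.1
        · exact (memB _ _).1 hcm.2
        · exact absurd rfl ha
      exact hc _ hca (by simpa using hcb)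
    have hu := Finset.card_union_add_card_inter (Bf 0) (Bf 1)
    have hA : A.card = (Bf 0).card + (Bf 1).card + (Bf 2).card := card_cons A
    have e : 2 * (m * 2 ^ (m - 1)) = m * 2 ^ m := by
      cases m with
      | zero => simp
      | succ k => simp only [Nat.add_sub_cancel, pow_succ]; ring
    have e2 : (m + 1) * 2 ^ (m + 1 - 1) = m * 2 ^ m + 2 ^ m := by
      simp only [Nat.add_sub_cancel]; ring
    rw [e2, pow_succ]
    omega

theorem card_lt_pairs {m : ℕ} (s : Finset (Fin m)) :
    ((s ×ˢ s).filter (fun x => x.1 < x.2)).card = s.card.choose 2 := by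
  have h1 : s.offDiag = (s ×ˢ s).filter (fun x => x.1 < x.2) ∪
      (s ×ˢ s).filter (fun x => x.2 < x.1) := by
    ext ⟨x, y⟩
    simp only [mem_offDiag, mem_union, mem_filter, mem_product]
    constructor
    · rintro ⟨hx, hy, hne⟩
      rcases lt_or_gt_of_ne hne with h | h
      · exact Or.inl ⟨⟨hx, hy⟩, h⟩
      · exact Or.inr ⟨⟨hx, hy⟩, h⟩
    · rintro (⟨⟨hx, hy⟩, h⟩ | ⟨⟨hx, hy⟩, h⟩)
      · exact ⟨hx, hy, ne_of_lt h⟩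
      · exact ⟨hx, hy, ne_of_gt h⟩
  have h2 : ((s ×ˢ s).filter (fun x => x.2 < x.1)).card =
      ((s ×ˢ s).filter (fun x => x.1 < x.2)).card := by
    apply Finset.card_bij (fun x _ => x.swap)
    · rintro ⟨x, y⟩ h
      simp only [mem_filter, mem_product, Prod.swap_prod_mk] at h ⊢
      tauto
    · intro x _ y _ h
      exact Prod.swap_injective h
    · rintro ⟨x, y⟩ h
      refine ⟨(y, x), ?_, rfl⟩
      simp only [mem_filter, mem_product] at h ⊢
      tauto
  have h3 : Disjoint ((s ×ˢ s).filter (fun x => x.1 < x.2))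
      ((s ×ˢ s).filter (fun x => x.2 < x.1)) := by
    rw [Finset.disjoint_filter]
    intro x _ h h'
    exact lt_asymm h h'
  have h4 := Finset.offDiag_card s
  rw [h1, Finset.card_union_of_disjoint h3, h2] at h4
  rw [Nat.choose_two_right, Nat.mul_sub, mul_one]
  omega

theorem card_pairs (m : ℕ) :
    ((univ : Finset (Fin m × Fin m)).filter (fun x => x.1 < x.2)).card = m.choose 2 := by
  have := card_lt_pairs (univ : Finset (Fin m))
  simpa using this

theorem forb_pK2_le (p m : ℕ) (hp : 1 ≤ p) :
    forb m 3 (pK2 p) ≤ 2 ^ m + m * 2 ^ (m - 1) + (p - 1) * m.choose 2 := by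
  apply csSup_le
  · refine ⟨0, ∅, ?_, rfl⟩
    rintro ⟨ρ, h⟩
    have := Multiset.count_le_of_le ![0, 0] h
    rw [count_cols, pK2, count_Fabcd] at this
    simp at this
    omega
  rintro n ⟨A, hA, rfl⟩
  have hex : ∀ x : Fin m × Fin m, ∃ ab : Fin 3 × Fin 3, x.1 < x.2 →
      (ab.1 ≠ 2 ∧ ab.2 ≠ 2 ∧ (A.filter (fun c => c x.1 = ab.1 ∧ c x.2 = ab.2)).card ≤ p - 1) := by
    rintro ⟨i, j⟩
    by_cases hij : i < j
    swap
    · exact ⟨(0, 0), fun h => absurd h hij⟩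
    by_contra hcon
    push Not at hcon
    have hc : ∀ a b : Fin 3, a ≠ 2 → b ≠ 2 →
        p ≤ (A.filter (fun c => c i = a ∧ c j = b)).card := by
      intro a b ha hb
      have := (hcon (a, b)).2 ha hb
      simp only at this
      omega
    apply hA
    refine ⟨⟨![i, j], ?_⟩, ?_⟩
    · intro x y hxy
      fin_cases x <;> fin_cases y <;> simp at hxy ⊢
      · exact absurd hxy (ne_of_lt hij)
      · exact absurd hxy (ne_of_gt hij)
    · rw [Multiset.le_iff_count]
      intro x
      have hx : x = ![x 0, x 1] := by
        funext k; fin_cases k <;> rfl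
      by_cases hx2 : x 0 ≠ 2 ∧ x 1 ≠ 2
      · have h1 : Multiset.count x (pK2 p) ≤ p := by
          rw [pK2, count_Fabcd]
          by_cases h00 : ![0, 0] = x
          · subst h00; simp
          by_cases h10 : ![1, 0] = x
          · subst h10; simp
          by_cases h01 : ![0, 1] = x
          · subst h01; simp
          rw [if_neg h00, if_neg h10, if_neg h01]
          split_ifs <;> simp
        refine h1.trans ?_
        conv_rhs => rw [hx]
        rw [count_cols]
        exact hc _ _ hx2.1 hx2.2
      · have h1 : Multiset.count x (pK2 p) = 0 := by
          rw [pK2, count_Fabcd]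
          rw [if_neg, if_neg, if_neg, if_neg] <;>
          · rintro rfl
            exact hx2 (by decide)
        omega
  choose g hg using hex
  set P := (univ : Finset (Fin m × Fin m)).filter (fun x => x.1 < x.2) with hP
  set D := P.biUnion (fun x => A.filter (fun c => c x.1 = (g x).1 ∧ c x.2 = (g x).2)) with hD
  have hDc : D.card ≤ m.choose 2 * (p - 1) := by
    rw [← card_pairs m]
    apply Finset.card_biUnion_le_card_mul
    intro x hx
    exact (hg x (by simpa [hP] using hx)).2.2
  have hR : (A \ D).card ≤ 2 ^ m + m * 2 ^ (m - 1) := by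
    apply card_noK2
    intro i j hij
    refine ⟨(g (i, j)).1, (g (i, j)).2, (hg (i, j) hij).1, (hg (i, j) hij).2.1, ?_⟩
    intro c hc hcc
    rw [Finset.mem_sdiff] at hc
    apply hc.2
    rw [hD, Finset.mem_biUnion]
    exact ⟨(i, j), by simpa [hP] using hij, by simpa using ⟨hc.1, hcc⟩⟩
  have := Finset.card_le_card_sdiff_add_card (s := A) (t := D)
  rw [mul_comm (p - 1)]
  omega

/-! ### The construction (double broom) -/

/-- forbidden symbol in the upper row of the pair -/
def pa (C : ℕ) {m : ℕ} (i : Fin m) : Fin 3 := if C ≤ i.1 then 1 else 0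

/-- forbidden symbol in the lower row of the pair -/
def pb (B : ℕ) {m : ℕ} (j : Fin m) : Fin 3 := if j.1 < B then 0 else 1

/-- The column `c` has the forbidden pattern on the pair of rows `i, j`. -/
def Viol (B C : ℕ) {m : ℕ} (c : Fin m → Fin 3) (i j : Fin m) : Prop :=
  i < j ∧ c i = pa C i ∧ c j = pb B j

/-- The vertex of the double broom attached to the row `e`. -/
def U (B C : ℕ) {m : ℕ} (e : Option (Fin m)) (h : Fin m) : Prop :=
  match e with
  | none => h.1 < B
  | some e => if h.1 < B then h ≠ e else (h = e ∨ (h < e ∧ h.1 < C))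

open Classical in
/-- The base columns. -/
noncomputable def bcol (B C : ℕ) {m : ℕ} (S : Finset (Fin m)) (e : Option (Fin m)) :
    Fin m → Fin 3 :=
  fun h => if h ∈ S then (if U B C e h then 1 else 0) else 2

theorem bcol_zero {B C m : ℕ} {S : Finset (Fin m)} {e : Option (Fin m)} {h : Fin m}
    (hh : bcol B C S e h = 0) : ¬ U B C e h := by
  unfold bcol at hh
  split_ifs at hh with h1 h2
  · simp at hh
  · exact h2
  · simp at hh

theorem bcol_one {B C m : ℕ} {S : Finset (Fin m)} {e : Option (Fin m)} {h : Fin m}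
    (hh : bcol B C S e h = 1) : U B C e h := by
  unfold bcol at hh
  split_ifs at hh with h1 h2
  · exact h2
  · simp at hh
  · simp at hh

theorem bcol_noViol {B C m : ℕ} (hBC : B ≤ C) (S : Finset (Fin m)) (e : Option (Fin m))
    (i j : Fin m) : ¬ Viol B C (bcol B C S e) i j := by
  rintro ⟨hij, hi, hj⟩
  unfold pa at hi
  unfold pb at hj
  rw [Fin.lt_def] at hij
  split_ifs at hi hj with h1 h2 h2
  · omega
  · have a1 := bcol_one hi
    have a2 := bcol_one hj
    cases e with
    | none => simp only [U] at a1 a2; omega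
    | some e =>
      simp only [U, Fin.lt_def, Fin.ext_iff] at a1 a2
      split_ifs at a1 a2 <;> omega
  · have a1 := bcol_zero hi
    have a2 := bcol_zero hj
    cases e with
    | none => simp only [U] at a1 a2; omega
    | some e =>
      simp only [U, Fin.lt_def, Fin.ext_iff] at a1 a2
      split_ifs at a1 a2 <;> omega
  · have a1 := bcol_zero hi
    have a2 := bcol_one hj
    cases e with
    | none => simp only [U] at a1 a2; omega
    | some e =>
      simp only [U, Fin.lt_def, Fin.ext_iff] at a1 a2
      split_ifs at a1 a2 <;> omega

theorem bcol_supp {B C m : ℕ} {S S' : Finset (Fin m)} {e e' : Option (Fin m)}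
    (h : bcol B C S e = bcol B C S' e') : S = S' := by
  have key : ∀ (S : Finset (Fin m)) (e : Option (Fin m)) (x : Fin m),
      x ∈ S ↔ bcol B C S e x ≠ 2 := by
    intro S e x
    unfold bcol
    split_ifs with h1 h2 <;> simp [h1]
  ext x
  rw [key S e, key S' e', h]

theorem bcol_U {B C m : ℕ} {S : Finset (Fin m)} {e e' : Option (Fin m)}
    (h : bcol B C S e = bcol B C S e') (x : Fin m) (hx : x ∈ S) :
    U B C e x ↔ U B C e' x := by
  have := congrFun h x
  unfold bcol at this
  rw [if_pos hx, if_pos hx] at this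
  split_ifs at this with h1 h2 h2
  · exact ⟨fun _ => h2, fun _ => h1⟩
  · simp at this
  · simp at this
  · exact ⟨fun h => absurd h h1, fun h => absurd h h2⟩

/-- The index type of the base columns. -/
abbrev Idx (m : ℕ) := Σ S : Finset (Fin m), Option {x // x ∈ S}

theorem bcol_inj (B C m : ℕ) :
    Function.Injective (fun x : Idx m => bcol B C x.1 (x.2.map Subtype.val)) := by
  rintro ⟨S, e⟩ ⟨S', e'⟩ h
  simp only at h
  obtain rfl := bcol_supp h
  congr 1
  have hU := bcol_U h
  match e, e' with
  | none, none => rfl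
  | none, some ⟨e', he'⟩ =>
    exfalso
    have := hU e' he'
    simp [U] at this
    omega
  | some ⟨e, he⟩, none =>
    exfalso
    have := hU e he
    simp [U] at this
    omega
  | some ⟨e, he⟩, some ⟨e', he'⟩ =>
    have h1 := hU e he
    have h2 := hU e' he'
    simp only [Option.map_some, U, Fin.lt_def, Fin.ext_iff] at h1 h2
    have : e = e' := by
      rw [Fin.ext_iff]
      grind
    subst this
    rfl

theorem card_Idx (m : ℕ) : Fintype.card (Idx m) = 2 ^ m + m * 2 ^ (m - 1) := by
  rw [Fintype.card_sigma]
  simp only [Fintype.card_option, Fintype.card_coe]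
  rw [Finset.sum_add_distrib]
  have h := Finset.sum_powerset_apply_card (f := fun n => n) (x := (univ : Finset (Fin m)))
  rw [Finset.powerset_univ] at h
  rw [h]
  simp only [Finset.card_univ, Fintype.card_fin, smul_eq_mul]
  have h2 := Nat.sum_range_mul_choose m
  simp only [mul_comm] at h2 ⊢
  rw [h2]
  simp [add_comm]

open Classical in
/-- columns with no violation -/
noncomputable def base (B C m : ℕ) : Finset (Fin m → Fin 3) :=
  univ.filter (fun c => ∀ i j, ¬ Viol B C c i j)

theorem card_base (B C m : ℕ) (hBC : B ≤ C) :
    2 ^ m + m * 2 ^ (m - 1) ≤ (base B C m).card := by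
  rw [← card_Idx, ← Finset.card_univ, ← Finset.card_image_of_injective univ (bcol_inj B C m)]
  apply Finset.card_le_card
  intro c hc
  rw [Finset.mem_image] at hc
  obtain ⟨x, _, rfl⟩ := hc
  simp only [base, mem_filter, mem_univ, true_and]
  exact bcol_noViol hBC _ _

open Classical in
/-- columns with exactly one violation, on the given pair of rows -/
noncomputable def extra (B C : ℕ) {m : ℕ} (x : Fin m × Fin m) : Finset (Fin m → Fin 3) :=
  univ.filter (fun c => ∀ i j, Viol B C c i j ↔ (i, j) = x)

/-- columns with violation on exactly `i, j` -/
def ecol (B C : ℕ) {m : ℕ} (i j : Fin m) (T : Finset (Fin m)) : Fin m → Fin 3 :=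
  fun h => if h = i then pa C i else if h = j then pb B j else
    if h ∈ T then (if h.1 < B then 1 else 0) else 2

/-- The leaf rows. -/
def leaves (B C m : ℕ) : Finset (Fin m) := univ.filter (fun h => h.1 < B ∨ C ≤ h.1)

theorem ecol_Viol {B C m : ℕ} (hBC : B ≤ C) {i j : Fin m} (hij : i < j) (T : Finset (Fin m))
    (hT : T ⊆ leaves B C m) (k l : Fin m) :
    Viol B C (ecol B C i j T) k l ↔ (k, l) = (i, j) := by
  have hother : ∀ h, h ≠ i → h ≠ j → ecol B C i j T h = 2 ∨
      (ecol B C i j T h = 1 ∧ h.1 < B) ∨ (ecol B C i j T h = 0 ∧ C ≤ h.1) := by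
    intro h hi hj
    unfold ecol
    rw [if_neg hi, if_neg hj]
    split_ifs with h1 h2
    · simp [h2]
    · have := hT h1
      simp only [leaves, mem_filter, mem_univ, true_and] at this
      simp; omega
    · simp
  have ha : ∀ h : Fin m, pa C h ≠ 2 := by
    intro h; unfold pa; split_ifs <;> simp
  have hb : ∀ h : Fin m, pb B h ≠ 2 := by
    intro h; unfold pb; split_ifs <;> simp
  have hka : ∀ h, h ≠ i → h ≠ j → ecol B C i j T h ≠ pa C h := by
    intro h hi hj he
    rcases hother h hi hj with h1 | ⟨h1, h2⟩ | ⟨h1, h2⟩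
    · exact ha h (by rw [← he, h1])
    · rw [h1, pa, if_neg (by omega)] at he; simp at he
    · rw [h1, pa, if_pos h2] at he; simp at he
  have hkb : ∀ h, h ≠ i → h ≠ j → ecol B C i j T h ≠ pb B h := by
    intro h hi hj he
    rcases hother h hi hj with h1 | ⟨h1, h2⟩ | ⟨h1, h2⟩
    · exact hb h (by rw [← he, h1])
    · rw [h1, pb, if_pos h2] at he; simp at he
    · rw [h1, pb, if_neg (by omega)] at he; simp at he
  constructor
  · rintro ⟨hkl, hk, hl⟩
    have k1 : k = i ∨ k = j := by
      by_contra hcon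
      push Not at hcon
      exact hka k hcon.1 hcon.2 hk
    have l1 : l = i ∨ l = j := by
      by_contra hcon
      push Not at hcon
      exact hkb l hcon.1 hcon.2 hl
    rcases k1 with rfl | rfl <;> rcases l1 with rfl | rfl
    · exact absurd hkl (lt_irrefl _)
    · rfl
    · exact absurd hkl (lt_asymm hij)
    · exact absurd hkl (lt_irrefl _)
  · intro h
    rw [Prod.mk.injEq] at h
    obtain ⟨rfl, rfl⟩ := h
    refine ⟨hij, ?_, ?_⟩
    · simp [ecol]
    · simp [ecol, ne_of_gt hij]

theorem card_starts (B m : ℕ) (h : B ≤ m) :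
    ((univ : Finset (Fin m)).filter (fun x => x.1 < B)).card = B := by
  rw [Fin.card_filter_val_lt]
  exact min_eq_right h

theorem card_ends (C m : ℕ) :
    ((univ : Finset (Fin m)).filter (fun x => C ≤ x.1)).card = m - C := by
  by_cases hC : C ≤ m
  · have h1 := card_starts C m hC
    have h2 := Finset.card_filter_add_card_filter_not (s := (univ : Finset (Fin m)))
      (fun x : Fin m => x.1 < C)
    simp only [not_lt] at h2
    rw [h1, Finset.card_univ, Fintype.card_fin] at h2
    omega
  · rw [Finset.card_eq_zero.2]
    · omega
    · rw [Finset.filter_eq_empty_iff]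
      intro x _
      have := x.2
      omega

theorem card_leaves (B C m : ℕ) (hBC : B ≤ C) (hC : C ≤ m) :
    (leaves B C m).card = B + (m - C) := by
  unfold leaves
  rw [Finset.filter_or, Finset.card_union_of_disjoint, card_starts B m (by omega), card_ends]
  rw [Finset.disjoint_filter]
  intro x _ h
  omega

theorem card_extra (B C m r : ℕ) (hBC : B ≤ C) (hC : C ≤ m) (hr : B + (m - C) = r + 2)
    (i j : Fin m) (hij : i < j) : 2 ^ r ≤ (extra B C (i, j)).card := by
  set L := ((leaves B C m).erase i).erase j with hL
  have hLc : r ≤ L.card := by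
    have h1 := Finset.pred_card_le_card_erase (s := leaves B C m) (a := i)
    have h2 := Finset.pred_card_le_card_erase (s := (leaves B C m).erase i) (a := j)
    have h3 := card_leaves B C m hBC hC
    rw [hL]
    omega
  calc 2 ^ r ≤ 2 ^ L.card := Nat.pow_le_pow_right (by norm_num) hLc
    _ = L.powerset.card := (Finset.card_powerset L).symm
    _ ≤ (extra B C (i, j)).card := by
      apply Finset.card_le_card_of_injOn (ecol B C i j)
      · intro T hT
        have hT' : T ⊆ L := by simpa using hT
        simp only [extra, coe_filter, mem_univ, true_and, Set.mem_ofPred_eq]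
        apply ecol_Viol hBC hij
        intro x hx
        exact Finset.mem_of_mem_erase (Finset.mem_of_mem_erase (hT' hx))
      · intro T hT T' hT' h
        have key : ∀ T : Finset (Fin m), T ⊆ L → ∀ x, x ∈ T ↔
            (x ≠ i ∧ x ≠ j ∧ ecol B C i j T x ≠ 2) := by
          intro T hT x
          constructor
          · intro hx
            have := hT hx
            simp only [hL, Finset.mem_erase] at this
            refine ⟨this.2.1, this.1, ?_⟩
            unfold ecol
            rw [if_neg this.2.1, if_neg this.1, if_pos hx]
            split_ifs <;> simp
          · rintro ⟨h1, h2, h3⟩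
            by_contra hx
            apply h3
            unfold ecol
            rw [if_neg h1, if_neg h2, if_neg hx]
        ext x
        rw [key T (by simpa using hT), key T' (by simpa using hT'), h]

theorem exists_family (B C m r p q : ℕ) (hBC : B ≤ C) (hC : C ≤ m) (hr : B + (m - C) = r + 2)
    (hp : 2 ≤ p) (hq : q ≤ p - 1) (hpr : p - 1 ≤ 2 ^ r) :
    ∃ A : Finset (Fin m → Fin 3), ¬ ConfigIn (Fabcd (p - q) p p (p - q)) A ∧
      2 ^ m + m * 2 ^ (m - 1) + (p - 1) * m.choose 2 ≤
        A.card + q * (B.choose 2 + (m - C).choose 2) := by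
  classical
  set P := (univ : Finset (Fin m × Fin m)).filter (fun x => x.1 < x.2) with hP
  set t : Fin m × Fin m → ℕ :=
    fun x => if x.2.1 < B ∨ C ≤ x.1.1 then p - 1 - q else p - 1 with ht
  have hex : ∀ x : Fin m × Fin m, ∃ X : Finset (Fin m → Fin 3), x.1 < x.2 →
      (X ⊆ extra B C x ∧ X.card = t x) := by
    rintro ⟨i, j⟩
    by_cases hij : i < j
    · have h1 := card_extra B C m r hBC hC hr i j hij
      have h2 : t (i, j) ≤ (extra B C (i, j)).card := by
        refine le_trans ?_ (hpr.trans h1)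
        simp only [ht]
        split_ifs <;> omega
      obtain ⟨X, hX, hc⟩ := Finset.exists_subset_card_eq h2
      exact ⟨X, fun _ => ⟨hX, hc⟩⟩
    · exact ⟨∅, fun h => absurd h hij⟩
  choose X hX using hex
  have hXm : ∀ x ∈ P, ∀ c ∈ X x, ∀ i j, Viol B C c i j ↔ (i, j) = x := by
    intro x hx c hc
    have := (hX x (by simpa [hP] using hx)).1 hc
    simpa [extra] using this
  set A := base B C m ∪ P.biUnion X with hA
  have hcount : ∀ i j, i < j →
      (A.filter (fun c => c i = pa C i ∧ c j = pb B j)).card ≤ t (i, j) := by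
    intro i j hij
    rw [← (hX (i, j) hij).2]
    apply Finset.card_le_card
    intro c hc
    rw [Finset.mem_filter, hA, Finset.mem_union, Finset.mem_biUnion] at hc
    obtain ⟨hcA, hv⟩ := hc
    have hv' : Viol B C c i j := ⟨hij, hv⟩
    rcases hcA with hcA | ⟨x, hx, hcx⟩
    · simp only [base, mem_filter, mem_univ, true_and] at hcA
      exact absurd hv' (hcA i j)
    · have := (hXm x hx c hcx i j).1 hv'
      rw [this]; exact hcx
  refine ⟨A, ?_, ?_⟩
  · rintro ⟨ρ, hρ⟩
    have hne : ρ 0 ≠ ρ 1 := by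
      intro h
      have := ρ.injective h
      simp at this
    have hFc : ∀ i j : Fin m, i < j →
        t (i, j) < Multiset.count ![pa C i, pb B j] (Fabcd (p - q) p p (p - q)) ∧
        t (i, j) < Multiset.count ![pb B j, pa C i] (Fabcd (p - q) p p (p - q)) := by
      intro i j hij
      rw [Fin.lt_def] at hij
      simp only [count_Fabcd, ht, pa, pb]
      by_cases h1 : C ≤ i.1
      · have h2 : ¬ j.1 < B := by omega
        simp [h1, h2]
        omega
      · by_cases h2 : j.1 < B
        · simp [h1, h2]
          omega
        · simp [h1, h2]
          omega
    rcases lt_or_gt_of_ne hne with h | h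
    · have h1 := Multiset.count_le_of_le ![pa C (ρ 0), pb B (ρ 1)] hρ
      rw [count_cols] at h1
      have h2 := hcount _ _ h
      have h3 := (hFc _ _ h).1
      omega
    · have h1 := Multiset.count_le_of_le ![pb B (ρ 0), pa C (ρ 1)] hρ
      rw [count_cols] at h1
      have h2 := hcount _ _ h
      have h3 := (hFc _ _ h).2
      have h4 : (A.filter (fun c => c (ρ 0) = pb B (ρ 0) ∧ c (ρ 1) = pa C (ρ 1))) =
          (A.filter (fun c => c (ρ 1) = pa C (ρ 1) ∧ c (ρ 0) = pb B (ρ 0))) := by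
        apply Finset.filter_congr
        intro c _
        exact and_comm
      rw [h4] at h1
      omega
  · have hd1 : Disjoint (base B C m) (P.biUnion X) := by
      rw [Finset.disjoint_left]
      intro c hc hc'
      rw [Finset.mem_biUnion] at hc'
      obtain ⟨x, hx, hcx⟩ := hc'
      simp only [base, mem_filter, mem_univ, true_and] at hc
      exact hc x.1 x.2 ((hXm x hx c hcx x.1 x.2).2 rfl)
    have hd2 : (P : Set (Fin m × Fin m)).PairwiseDisjoint X := by
      intro x hx y hy hxy
      simp only [Function.onFun]
      rw [Finset.disjoint_left]
      intro c hc hc'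
      apply hxy
      exact (hXm y hy c hc' x.1 x.2).1 ((hXm x hx c hc x.1 x.2).2 rfl)
    have hs : ∑ x ∈ P, (X x).card = ∑ x ∈ P, t x := by
      apply Finset.sum_congr rfl
      intro x hx
      exact (hX x (by simpa [hP] using hx)).2
    rw [hA, Finset.card_union_of_disjoint hd1, Finset.card_biUnion hd2, hs]
    have hb := card_base B C m hBC
    set K := P.filter (fun x => x.2.1 < B ∨ C ≤ x.1.1) with hK
    have hKc : K.card ≤ B.choose 2 + (m - C).choose 2 := by
      have e1 := card_lt_pairs ((univ : Finset (Fin m)).filter (fun x => x.1 < B))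
      have e2 := card_lt_pairs ((univ : Finset (Fin m)).filter (fun x => C ≤ x.1))
      rw [card_starts B m (by omega)] at e1
      rw [card_ends] at e2
      rw [← e1, ← e2]
      refine le_trans (Finset.card_le_card ?_) (Finset.card_union_le _ _)
      rintro ⟨i, j⟩ hx
      simp only [hK, hP, mem_filter, mem_univ, true_and, mem_union, mem_product, Fin.lt_def]
        at hx ⊢
      omega
    have hsum : (p - 1) * m.choose 2 = ∑ x ∈ P, t x + q * K.card := by
      have e : ∑ x ∈ P, (t x + if x.2.1 < B ∨ C ≤ x.1.1 then q else 0) = ∑ x ∈ P, (p - 1) := by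
        apply Finset.sum_congr rfl
        intro x _
        simp only [ht]
        split_ifs <;> omega
      rw [Finset.sum_add_distrib, Finset.sum_const, card_pairs, smul_eq_mul,
        ← Finset.sum_filter, Finset.sum_const, smul_eq_mul, ← hK] at e
      rw [mul_comm, ← e, mul_comm q]
    have := Nat.mul_le_mul_left q hKc
    omega

theorem forb_pqppq_lower (p q m : ℕ) (hp : 2 ≤ p) (hq : q ≤ p - 1)
    (hm : 2 * (Nat.choose ((Nat.clog 2 (p - 1) + 1) / 2 + 1) 2
      + Nat.choose (Nat.clog 2 (p - 1) / 2 + 1) 2) + 2 ≤ m) :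
    forb m 3 (pK2 p)
        - q * (Nat.choose ((Nat.clog 2 (p - 1) + 1) / 2 + 1) 2
          + Nat.choose (Nat.clog 2 (p - 1) / 2 + 1) 2)
      ≤ forb m 3 (Fabcd (p - q) p p (p - q)) ∧
    forb m 3 (pK2 p)
        - q * (Nat.choose ((Nat.clog 2 (p - 1) + 1) / 2 + 1) 2
          + Nat.choose (Nat.clog 2 (p - 1) / 2 + 1) 2)
      = 2 ^ m + m * 2 ^ (m - 1) + (p - 1) * Nat.choose m 2
          - q * (Nat.choose ((Nat.clog 2 (p - 1) + 1) / 2 + 1) 2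
            + Nat.choose (Nat.clog 2 (p - 1) / 2 + 1) 2) := by
  set r := Nat.clog 2 (p - 1) with hr
  have hpr : p - 1 ≤ 2 ^ r := Nat.le_pow_clog (by norm_num) _
  have hch : ∀ n : ℕ, n ≤ (n + 1).choose 2 := by
    intro n
    rw [Nat.choose_succ_succ' n 1, Nat.choose_one_right]
    omega
  have g1 := hch ((r + 1) / 2)
  have g2 := hch (r / 2)
  have fam : ∀ q, q ≤ p - 1 → 2 ^ m + m * 2 ^ (m - 1) + (p - 1) * m.choose 2 ≤
      forb m 3 (Fabcd (p - q) p p (p - q)) +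
        q * (((r + 1) / 2 + 1).choose 2 + (r / 2 + 1).choose 2) := by
    intro q hq
    obtain ⟨A, hA, hc⟩ := exists_family ((r + 1) / 2 + 1) (m - (r / 2 + 1)) m r p q
      (by omega) (by omega) (by omega) hp hq hpr
    have e : m - (m - (r / 2 + 1)) = r / 2 + 1 := by omega
    rw [e] at hc
    have := le_forb m _ A hA
    omega
  have hlow : 2 ^ m + m * 2 ^ (m - 1) + (p - 1) * m.choose 2 ≤ forb m 3 (pK2 p) := by
    have := fam 0 (by omega)
    simpa [pK2] using this
  have heq := le_antisymm (forb_pK2_le p m (by omega)) hlow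
  rw [heq]
  refine ⟨?_, rfl⟩
  have := fam q hq
  omega
end
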